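/- Under Conditions 1–3, with t = [nu] for fixed u ∈ (0,1), the processes {Z_out,w([nu]) : 0 < u < 1} and {Z_in([nu]) : 0 < u < 1} converge jointly in finite-dimensional distributions, as n → ∞, to centered Gaussian processes that are independent of each other: for any finite set of points 0 < u_1 < … < u_k < 1, the random vector (Z_out,w([nu_1]),…,Z_out,w([nu_k]), Z_in([nu_1]),…,Z_in([nu_k])) converges in distribution to a centered multivariate Gaussian vector whose covariance matrix is the limit of the corresponding permutation-null covariance matrices, and in which the Z_out,w-block is independent of the Z_in-block. -/

import Mathlib

open scoped BigOperators Classical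

noncomputable section

namespace CPD

/-- Nodes: `n` individuals, each with `ℓ` repeated measurements. -/
abbrev Node (n ℓ : ℕ) := Fin n × Fin ℓ

/-- The (unordered) pair of individuals joined by an edge. -/
def indPair {n ℓ : ℕ} (e : Sym2 (Node n ℓ)) : Sym2 (Fin n) := Sym2.map Prod.fst e

/-- Between-individual edges of the graph `Gr`. -/
def Gout {n ℓ : ℕ} (Gr : Finset (Sym2 (Node n ℓ))) : Finset (Sym2 (Node n ℓ)) :=
  Gr.filter fun e => ¬ (indPair e).IsDiag

/-- Within-individual edges of the graph `Gr`. -/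
def Gin {n ℓ : ℕ} (Gr : Finset (Sym2 (Node n ℓ))) : Finset (Sym2 (Node n ℓ)) :=
  Gr.filter fun e => (indPair e).IsDiag

/-- `D Gr u v`: the number of edges of `Gr` between individual `u` and individual `v`
(for `u = v`, the number of within-individual edges of individual `u`). -/
def D {n ℓ : ℕ} (Gr : Finset (Sym2 (Node n ℓ))) (u v : Fin n) : ℕ :=
  (Gr.filter fun e => indPair e = s(u, v)).card

/-- `Ddeg Gr u = ∑_{v ≠ u} D Gr u v`. -/
def Ddeg {n ℓ : ℕ} (Gr : Finset (Sym2 (Node n ℓ))) (u : Fin n) : ℕ :=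
  ∑ v ∈ Finset.univ.filter fun v => v ≠ u, D Gr u v

/-- Number of between-individual edges both of whose endpoints belong to individuals whose
permuted label (in `{1, …, n}`) is `≤ t`. -/
def Rout1 {n ℓ : ℕ} (Gr : Finset (Sym2 (Node n ℓ))) (t : ℕ) (σ : Equiv.Perm (Fin n)) : ℕ :=
  ((Gout Gr).filter fun e => ∀ x ∈ e, ((σ x.1 : ℕ) + 1 ≤ t)).card

/-- Number of between-individual edges both of whose endpoints belong to individuals whose
permuted label is `> t`. -/
def Rout2 {n ℓ : ℕ} (Gr : Finset (Sym2 (Node n ℓ))) (t : ℕ) (σ : Equiv.Perm (Fin n)) : ℕ :=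
  ((Gout Gr).filter fun e => ∀ x ∈ e, (t ≤ (σ x.1 : ℕ))).card

/-- Number of within-individual edges both of whose endpoints belong to individuals whose
permuted label is `≤ t`. -/
def Rin1 {n ℓ : ℕ} (Gr : Finset (Sym2 (Node n ℓ))) (t : ℕ) (σ : Equiv.Perm (Fin n)) : ℕ :=
  ((Gin Gr).filter fun e => ∀ x ∈ e, ((σ x.1 : ℕ) + 1 ≤ t)).card

/-- Expectation under the permutation null distribution (uniform over the `n!` permutations of
the individual labels). -/
def pexp {n : ℕ} (f : Equiv.Perm (Fin n) → ℝ) : ℝ :=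
  (∑ σ : Equiv.Perm (Fin n), f σ) / (Nat.factorial n)

/-- Covariance under the permutation null distribution. -/
def pcov {n : ℕ} (f g : Equiv.Perm (Fin n) → ℝ) : ℝ :=
  pexp fun σ => (f σ - pexp f) * (g σ - pexp g)

/-- Variance under the permutation null distribution. -/
def pvar {n : ℕ} (f : Equiv.Perm (Fin n) → ℝ) : ℝ := pcov f f

/-- The weighted edge-count statistic
`R_out,w(t) = ((n−t−1)·R_out,1(t) + (t−1)·R_out,2(t))/(n−2)`. -/
def Routw {n ℓ : ℕ} (Gr : Finset (Sym2 (Node n ℓ))) (t : ℕ) (σ : Equiv.Perm (Fin n)) : ℝ :=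
  (((n : ℝ) - t - 1) * (Rout1 Gr t σ : ℝ) + ((t : ℝ) - 1) * (Rout2 Gr t σ : ℝ)) / ((n : ℝ) - 2)

/-- The difference edge-count statistic `R_out,d(t) = R_out,1(t) − R_out,2(t)`. -/
def Routd {n ℓ : ℕ} (Gr : Finset (Sym2 (Node n ℓ))) (t : ℕ) (σ : Equiv.Perm (Fin n)) : ℝ :=
  (Rout1 Gr t σ : ℝ) - (Rout2 Gr t σ : ℝ)

/-- Standardized weighted between-individual statistic `Z_out,w(t)`. -/
def Zoutw {n ℓ : ℕ} (Gr : Finset (Sym2 (Node n ℓ))) (t : ℕ) (σ : Equiv.Perm (Fin n)) : ℝ :=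
  (Routw Gr t σ - pexp (Routw Gr t)) / Real.sqrt (pvar (Routw Gr t))

/-- Standardized difference statistic `Z_out,d(t)`. -/
def Zoutd {n ℓ : ℕ} (Gr : Finset (Sym2 (Node n ℓ))) (t : ℕ) (σ : Equiv.Perm (Fin n)) : ℝ :=
  (Routd Gr t σ - pexp (Routd Gr t)) / Real.sqrt (pvar (Routd Gr t))

/-- Standardized within-individual statistic `Z_in(t)`. -/
def Zin {n ℓ : ℕ} (Gr : Finset (Sym2 (Node n ℓ))) (t : ℕ) (σ : Equiv.Perm (Fin n)) : ℝ :=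
  ((Rin1 Gr t σ : ℝ) - pexp (fun τ => (Rin1 Gr t τ : ℝ))) /
    Real.sqrt (pvar (fun τ => (Rin1 Gr t τ : ℝ)))

/-- The constant
`ϱ = (Σ_u D_uu·D_u − (2/n)|G_in||G_out|) / sqrt((Σ_u D_u² − 4|G_out|²/n)(Σ_u D_uu² − |G_in|²/n))`. -/
def varrho {n ℓ : ℕ} (Gr : Finset (Sym2 (Node n ℓ))) : ℝ :=
  ((∑ u : Fin n, (D Gr u u : ℝ) * (Ddeg Gr u : ℝ)) -
      2 / (n : ℝ) * ((Gin Gr).card : ℝ) * ((Gout Gr).card : ℝ)) /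
    Real.sqrt (((∑ u : Fin n, (Ddeg Gr u : ℝ) ^ 2) - 4 * ((Gout Gr).card : ℝ) ^ 2 / (n : ℝ)) *
      ((∑ u : Fin n, (D Gr u u : ℝ) ^ 2) - ((Gin Gr).card : ℝ) ^ 2 / (n : ℝ)))


open Asymptotics

/-- `e'` shares an individual with `e`. -/
def touches {n ℓ : ℕ} (e e' : Sym2 (Node n ℓ)) : Prop := ∃ x ∈ e', ∃ y ∈ e, x.1 = y.1

/-- The neighborhood `A_e` of an edge `e`: for a between-individual edge `e` joining individuals
`u, v`, the between-individual edges with an endpoint in `C_u ∪ C_v`; for a within-individual edge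
`e` of individual `u`, the between-individual edges with an endpoint in `C_u` together with the
within-individual edges of individual `u`. -/
def Ae {n ℓ : ℕ} (Gr : Finset (Sym2 (Node n ℓ))) (e : Sym2 (Node n ℓ)) :
    Finset (Sym2 (Node n ℓ)) :=
  if (indPair e).IsDiag then Gr.filter fun e' => touches e e'
  else (Gout Gr).filter fun e' => touches e e'

/-- `B_e = ∪_{ẽ ∈ A_e} A_ẽ`. -/
def Be {n ℓ : ℕ} (Gr : Finset (Sym2 (Node n ℓ))) (e : Sym2 (Node n ℓ)) :
    Finset (Sym2 (Node n ℓ)) :=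
  (Ae Gr e).biUnion fun e' => Ae Gr e'

/-- `a` and `b` are of the same (exact) order. -/
def SameOrder (a b : ℕ → ℝ) : Prop :=
  ∃ c C : ℝ, 0 < c ∧ ∀ᶠ n in Filter.atTop, c * b n ≤ a n ∧ a n ≤ C * b n

/-- Condition 1: `|G_out| = O(n)` and `|G_in| = O(n)` (exact order `n`). -/
def Cond1 (ℓ : ℕ) (Gr : ∀ n : ℕ, Finset (Sym2 (Node n ℓ))) : Prop :=
  SameOrder (fun n => ((Gout (Gr n)).card : ℝ)) (fun n => (n : ℝ)) ∧
  SameOrder (fun n => ((Gin (Gr n)).card : ℝ)) (fun n => (n : ℝ))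

/-- Condition 2: `Σ_u D_u² − 4|G_out|²/n = O(n)` and `Σ_u D_uu² − |G_in|²/n = O(n)`
(exact order `n`). -/
def Cond2 (ℓ : ℕ) (Gr : ∀ n : ℕ, Finset (Sym2 (Node n ℓ))) : Prop :=
  SameOrder
    (fun n => (∑ u : Fin n, (Ddeg (Gr n) u : ℝ) ^ 2) - 4 * ((Gout (Gr n)).card : ℝ) ^ 2 / (n : ℝ))
    (fun n => (n : ℝ)) ∧
  SameOrder
    (fun n => (∑ u : Fin n, (D (Gr n) u u : ℝ) ^ 2) - ((Gin (Gr n)).card : ℝ) ^ 2 / (n : ℝ))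
    (fun n => (n : ℝ))

/-- Condition 3: `Σ_{e ∈ G_out} |A_out,e|·|B_out,e| = o(n^{1.5})`. -/
def Cond3 (ℓ : ℕ) (Gr : ∀ n : ℕ, Finset (Sym2 (Node n ℓ))) : Prop :=
  (fun n : ℕ => ∑ e ∈ Gout (Gr n), ((Ae (Gr n) e).card : ℝ) * ((Be (Gr n) e).card : ℝ))
    =o[Filter.atTop] fun n : ℕ => (n : ℝ) ^ (1.5 : ℝ)

/-- A centered Gaussian measure: every continuous linear functional is distributed as a centered
one-dimensional Gaussian. -/
def IsCenteredGaussian {E : Type*} [NormedAddCommGroup E] [NormedSpace ℝ E] [MeasurableSpace E]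
    (μ : MeasureTheory.Measure E) : Prop :=
  ∀ L : E →L[ℝ] ℝ, ∃ v : NNReal, μ.map L = ProbabilityTheory.gaussianReal 0 v

section Averages

open Finset

lemma pexp_eq_expect {n : ℕ} (f : Equiv.Perm (Fin n) → ℝ) : pexp f = 𝔼 σ, f σ := by
  simp [pexp, Fintype.expect_eq_sum_div_card, Fintype.card_perm]

lemma abs_expect_mul_le {Ω : Type*} [Fintype Ω] (f g : Ω → ℝ) :
    |𝔼 ω, f ω * g ω| ≤ √((𝔼 ω, f ω ^ 2) * 𝔼 ω, g ω ^ 2) :=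
  Real.abs_le_sqrt (expect_mul_sq_le_sq_mul_sq _ _ _)

lemma expect_abs_le_sqrt {Ω : Type*} [Fintype Ω] [Nonempty Ω] (f : Ω → ℝ) :
    𝔼 ω, |f ω| ≤ √(𝔼 ω, f ω ^ 2) := by
  have h := abs_expect_mul_le (fun ω => |f ω|) (fun _ => 1)
  simp only [mul_one, sq_abs, one_pow, Fintype.expect_const] at h
  exact (le_abs_self _).trans h

lemma expect_mul_eq_of_dependsOn {ι α 𝕜 : Type*} [Fintype ι] [DecidableEq ι] [Fintype α]
    [Nonempty α] [Field 𝕜] [CharZero 𝕜] {F G : (ι → α) → 𝕜} {s t : Set ι} (hF : DependsOn F s)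
    (hG : DependsOn G t) (hst : Disjoint s t) :
    𝔼 V, F V * G V = (𝔼 V, F V) * 𝔼 V, G V := by
  classical
  rw [Fintype.expect_mul_expect, ← expect_product', univ_product_univ]
  have h1 : 𝔼 V, F V * G V = 𝔼 p : (ι → α) × (ι → α), F p.1 * G p.1 := by
    rw [← univ_product_univ, expect_product]
    simp
  rw [h1]
  let Φ : (ι → α) × (ι → α) → (ι → α) × (ι → α) :=
    fun p => (s.piecewise p.1 p.2, s.piecewise p.2 p.1)
  have hΦ : Function.Involutive Φ := by
    intro p
    ext i <;> by_cases h : i ∈ s <;> simp [Φ, Set.piecewise, h]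
  refine (Fintype.expect_equiv hΦ.toPerm _ _ fun p => ?_).symm
  have e1 : F (Φ p).1 = F p.1 := hF fun i hi => by simp [Φ, Set.piecewise, hi]
  have e2 : G (Φ p).1 = G p.2 := hG fun i hi => by
    have : i ∉ s := fun h => hst.le_bot ⟨h, hi⟩
    simp [Φ, Set.piecewise, this]
  simp [e1, e2]

end Averages

section LocalDependence

open Finset Complex

lemma norm_exp_I_mul_sub_one_sub_le (x : ℝ) :
    ‖exp (I * x) - 1 - I * x‖ ≤ x ^ 2 := by
  let g : ℝ → ℂ := fun s => exp (I * (s * x)) - 1 - I * (s * x)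
  have hd : ∀ s : ℝ, HasDerivAt g (I * x * (exp (I * (s * x)) - 1)) s := by
    intro s
    have h0 : HasDerivAt (fun s : ℝ => I * ((s : ℂ) * x)) (I * x) s := by
      simpa using ((Complex.ofRealCLM.hasDerivAt (x := s)).mul_const (x : ℂ)).const_mul I
    have := ((h0.cexp).sub_const 1).sub h0
    refine this.congr_deriv ?_
    ring
  have h := norm_image_sub_le_of_norm_deriv_le_segment_01' (f := g) (C := x ^ 2)
    (f' := fun s => I * x * (exp (I * (s * x)) - 1)) (fun s _ => (hd s).hasDerivWithinAt) ?_
  · simpa [g] using h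
  · intro s hs
    have h2 := Real.norm_exp_I_mul_ofReal_sub_one_le (x := s * x)
    push_cast at h2
    rw [norm_mul, norm_mul, norm_I, one_mul, norm_real]
    refine (mul_le_mul_of_nonneg_left h2 (norm_nonneg _)).trans ?_
    rw [norm_mul, Real.norm_eq_abs, Real.norm_eq_abs, abs_of_nonneg hs.1, ← sq_abs x]
    nlinarith [hs.2, sq_nonneg |x|]

lemma norm_exp_I_mul_sub_exp_le (x y : ℝ) :
    ‖exp (I * x) - exp (I * y)‖ ≤ |x - y| := by
  have h : exp (I * x) - exp (I * y) = exp (I * y) * (exp (I * ((x - y : ℝ) : ℂ)) - 1) := by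
    rw [mul_sub, ← exp_add]
    push_cast
    ring_nf
  rw [h, norm_mul, norm_exp_I_mul_ofReal, one_mul]
  exact Real.norm_exp_I_mul_ofReal_sub_one_le

/-- Indices of summands sharing a coordinate with the summand `p`. -/
def nbhd {ι P : Type*} [DecidableEq ι] [Fintype P] (supp : P → Finset ι) (p : P) : Finset P :=
  univ.filter fun q => ¬ Disjoint (supp p) (supp q)

lemma mem_nbhd {ι P : Type*} [DecidableEq ι] [Fintype P] {supp : P → Finset ι} {p q : P} :
    q ∈ nbhd supp p ↔ ¬ Disjoint (supp p) (supp q) := by simp [nbhd]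

lemma mem_nbhd_comm {ι P : Type*} [DecidableEq ι] [Fintype P] {supp : P → Finset ι} {p q : P} :
    q ∈ nbhd supp p ↔ p ∈ nbhd supp q := by
  rw [mem_nbhd, mem_nbhd, disjoint_comm]

lemma abs_sum_le_of_subset {P : Type*} {s t : Finset P} (hst : s ⊆ t) {x M : P → ℝ}
    (h : ∀ p, |x p| ≤ M p) : |∑ p ∈ s, x p| ≤ ∑ p ∈ t, M p :=
  (abs_sum_le_sum_abs _ _).trans <| (sum_le_sum fun p _ => h p).trans <|
    sum_le_sum_of_subset_of_nonneg hst fun p _ _ => (abs_nonneg _).trans (h p)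

lemma norm_expect_le_const {Ω : Type*} [Fintype Ω] [Nonempty Ω] {f : Ω → ℂ} {c : ℝ}
    (h : ∀ ω, ‖f ω‖ ≤ c) : ‖𝔼 ω, f ω‖ ≤ c :=
  (RCLike.norm_expect_le (K := ℂ)).trans (expect_le univ_nonempty fun ω _ => h ω)

lemma dependsOn_exp_sum {ι α P : Type*} {ξ : P → (ι → α) → ℝ} {supp : P → Finset ι}
    (hdep : ∀ p, DependsOn (ξ p) (supp p : Set ι)) (θ : ℝ) (s : Finset P)
    (u : Set ι) (hs : ∀ p ∈ s, (supp p : Set ι) ⊆ u) :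
    DependsOn (fun V => exp (I * ((θ * ∑ p ∈ s, ξ p V : ℝ) : ℂ))) u := by
  intro x y h
  have : ∑ p ∈ s, ξ p x = ∑ p ∈ s, ξ p y :=
    sum_congr rfl fun p hp => hdep p fun i hi => h i (hs p hp hi)
  simp only [this]

variable {ι α P : Type*} [Fintype ι] [DecidableEq ι] [Fintype α] [Nonempty α] [Fintype P]
  {ξ : P → (ι → α) → ℝ} {supp : P → Finset ι} {M : P → ℝ}

lemma norm_expect_summand_mul_exp_sub_le (hdep : ∀ p, DependsOn (ξ p) (supp p : Set ι))
    (hmean : ∀ p, 𝔼 V, ξ p V = 0) (hM : ∀ p V, |ξ p V| ≤ M p) (θ : ℝ) (p : P) :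
    ‖(𝔼 V, (ξ p V : ℂ) * exp (I * ((θ * ∑ q, ξ q V : ℝ) : ℂ))) -
        ∑ q ∈ nbhd supp p, I * θ * ((𝔼 V, ξ p V * ξ q V : ℝ) : ℂ) *
          𝔼 V, exp (I * ((θ * ∑ q, ξ q V : ℝ) : ℂ))‖ ≤
      θ ^ 2 * (M p * (∑ q ∈ nbhd supp p, M q) ^ 2 + ∑ q ∈ nbhd supp p, M p * M q *
        ((∑ r ∈ nbhd supp p, M r) + 2 * ∑ r ∈ nbhd supp q, M r)) := by
  have hM0 : ∀ p, 0 ≤ M p := fun p => (abs_nonneg _).trans (hM p (fun _ => Classical.arbitrary α))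
  set N := nbhd supp p with hN
  set W : (ι → α) → ℝ := fun V => ∑ q, ξ q V with hW
  set η : (ι → α) → ℝ := fun V => ∑ q ∈ N, ξ q V with hη
  set W1 : (ι → α) → ℝ := fun V => ∑ q ∈ Nᶜ, ξ q V with hW1
  set W2 : P → (ι → α) → ℝ := fun q V => ∑ r ∈ Nᶜ ∩ (nbhd supp q)ᶜ, ξ r V with hW2
  have hsplit : ∀ V, W V = η V + W1 V := fun V => (sum_add_sum_compl N _).symm
  have hz1 : 𝔼 V, (ξ p V : ℂ) * exp (I * ((θ * W1 V : ℝ) : ℂ)) = 0 := by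
    rw [expect_mul_eq_of_dependsOn (s := (supp p : Set ι)) (t := (supp p : Set ι)ᶜ)
      (fun x y h => by rw [hdep p h])
      (dependsOn_exp_sum hdep θ _ _ fun q hq => ?_) disjoint_compl_right]
    · have : 𝔼 V, (ξ p V : ℂ) = ((𝔼 V, ξ p V : ℝ) : ℂ) := (ofReal_expect _ _).symm
      rw [this, hmean, ofReal_zero, zero_mul]
    · rw [mem_compl, hN, mem_nbhd, not_not] at hq
      rw [Set.subset_compl_iff_disjoint_left]
      exact_mod_cast hq
  have hz2 : ∀ q, 𝔼 V, ((ξ p V * ξ q V : ℝ) : ℂ) * exp (I * ((θ * W2 q V : ℝ) : ℂ)) =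
      ((𝔼 V, ξ p V * ξ q V : ℝ) : ℂ) * 𝔼 V, exp (I * ((θ * W2 q V : ℝ) : ℂ)) := by
    intro q
    rw [expect_mul_eq_of_dependsOn (s := (supp p ∪ supp q : Set ι))
      (t := (supp p ∪ supp q : Set ι)ᶜ)
      (fun x y h => by
        rw [hdep p fun i hi => h i (Or.inl hi), hdep q fun i hi => h i (Or.inr hi)])
      (dependsOn_exp_sum hdep θ _ _ fun r hr => ?_) disjoint_compl_right]
    · rw [ofReal_expect]
    · rw [mem_inter, mem_compl, mem_compl, hN, mem_nbhd, mem_nbhd, not_not, not_not] at hr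
      rw [Set.subset_compl_iff_disjoint_left, Set.disjoint_union_left]
      exact_mod_cast hr
  have hpt : ∀ V, (ξ p V : ℂ) * exp (I * ((θ * W V : ℝ) : ℂ)) =
      (ξ p V : ℂ) * exp (I * ((θ * W1 V : ℝ) : ℂ)) +
      (∑ q ∈ N, I * θ * (((ξ p V * ξ q V : ℝ) : ℂ) * exp (I * ((θ * W2 q V : ℝ) : ℂ))) +
      ((ξ p V : ℂ) * exp (I * ((θ * W1 V : ℝ) : ℂ)) *
        (exp (I * ((θ * η V : ℝ) : ℂ)) - 1 - I * ((θ * η V : ℝ) : ℂ)) +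
      ∑ q ∈ N, I * θ * (((ξ p V * ξ q V : ℝ) : ℂ) *
        (exp (I * ((θ * W1 V : ℝ) : ℂ)) - exp (I * ((θ * W2 q V : ℝ) : ℂ)))))) := by
    intro V
    have e1 : exp (I * ((θ * W V : ℝ) : ℂ)) =
        exp (I * ((θ * W1 V : ℝ) : ℂ)) * exp (I * ((θ * η V : ℝ) : ℂ)) := by
      rw [← exp_add, hsplit]
      push_cast
      ring_nf
    have e2 : (ξ p V : ℂ) * exp (I * ((θ * W1 V : ℝ) : ℂ)) * (I * ((θ * η V : ℝ) : ℂ)) =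
        ∑ q ∈ N, I * θ * (((ξ p V * ξ q V : ℝ) : ℂ) * exp (I * ((θ * W1 V : ℝ) : ℂ))) := by
      rw [hη]
      push_cast
      rw [mul_sum, mul_sum, mul_sum]
      exact sum_congr rfl fun q _ => by ring
    rw [e1]
    simp only [mul_sub, sum_sub_distrib] at e2 ⊢
    rw [e2]
    ring
  have hexp : (𝔼 V, (ξ p V : ℂ) * exp (I * ((θ * W V : ℝ) : ℂ))) -
      ∑ q ∈ N, I * θ * ((𝔼 V, ξ p V * ξ q V : ℝ) : ℂ) * 𝔼 V, exp (I * ((θ * W V : ℝ) : ℂ)) =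
      (𝔼 V, (ξ p V : ℂ) * exp (I * ((θ * W1 V : ℝ) : ℂ)) *
        (exp (I * ((θ * η V : ℝ) : ℂ)) - 1 - I * ((θ * η V : ℝ) : ℂ))) +
      ∑ q ∈ N, I * θ * ((𝔼 V, ((ξ p V * ξ q V : ℝ) : ℂ) *
        (exp (I * ((θ * W1 V : ℝ) : ℂ)) - exp (I * ((θ * W2 q V : ℝ) : ℂ)))) +
        ((𝔼 V, ξ p V * ξ q V : ℝ) : ℂ) * 𝔼 V, (exp (I * ((θ * W2 q V : ℝ) : ℂ)) -
          exp (I * ((θ * W V : ℝ) : ℂ)))) := by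
    simp_rw [hpt]
    rw [expect_add_distrib, expect_add_distrib, expect_add_distrib, hz1, expect_sum_comm,
      expect_sum_comm]
    simp_rw [← mul_expect, hz2, expect_sub_distrib]
    simp only [mul_add, sum_add_distrib, mul_sub, sum_sub_distrib, ← mul_assoc]
    ring
  rw [hexp]
  have hb1 : ‖𝔼 V, (ξ p V : ℂ) * exp (I * ((θ * W1 V : ℝ) : ℂ)) *
        (exp (I * ((θ * η V : ℝ) : ℂ)) - 1 - I * ((θ * η V : ℝ) : ℂ))‖ ≤
      θ ^ 2 * (M p * (∑ q ∈ N, M q) ^ 2) := by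
    refine norm_expect_le_const fun V => ?_
    rw [norm_mul, norm_mul, norm_exp_I_mul_ofReal, mul_one, norm_real, Real.norm_eq_abs]
    have h1 := norm_exp_I_mul_sub_one_sub_le (θ * η V)
    have h2 : |η V| ≤ ∑ q ∈ N, M q := abs_sum_le_of_subset subset_rfl fun q => hM q V
    have h3 : η V ^ 2 ≤ (∑ q ∈ N, M q) ^ 2 := by
      rw [← sq_abs]; gcongr
    calc _ ≤ M p * (θ * η V) ^ 2 := mul_le_mul (hM p V) h1 (norm_nonneg _) (hM0 p)
      _ = θ ^ 2 * (M p * η V ^ 2) := by ring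
      _ ≤ _ := by have := hM0 p; gcongr
  have hb2 : ∀ q ∈ N, ‖I * θ * ((𝔼 V, ((ξ p V * ξ q V : ℝ) : ℂ) *
        (exp (I * ((θ * W1 V : ℝ) : ℂ)) - exp (I * ((θ * W2 q V : ℝ) : ℂ)))) +
        ((𝔼 V, ξ p V * ξ q V : ℝ) : ℂ) * 𝔼 V, (exp (I * ((θ * W2 q V : ℝ) : ℂ)) -
          exp (I * ((θ * W V : ℝ) : ℂ))))‖ ≤
      θ ^ 2 * (M p * M q * ((∑ r ∈ N, M r) + 2 * ∑ r ∈ nbhd supp q, M r)) := by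
    intro q _
    have hd1 : ∀ V, |W1 V - W2 q V| ≤ ∑ r ∈ nbhd supp q, M r := by
      intro V
      have : W1 V - W2 q V = ∑ r ∈ Nᶜ \ (nbhd supp q)ᶜ, ξ r V := by
        rw [hW1, hW2]
        simp only
        rw [← sum_inter_add_sum_sdiff Nᶜ (nbhd supp q)ᶜ]
        ring
      rw [this]
      refine abs_sum_le_of_subset ?_ fun r => hM r V
      intro r hr
      simpa using (mem_sdiff.1 hr).2
    have hd2 : ∀ V, |W2 q V - W V| ≤ (∑ r ∈ N, M r) + ∑ r ∈ nbhd supp q, M r := by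
      intro V
      have h1 := hd1 V
      have h2 : |η V| ≤ ∑ q ∈ N, M q := abs_sum_le_of_subset subset_rfl fun q => hM q V
      have h3 : W2 q V - W V = -η V - (W1 V - W2 q V) := by rw [hsplit]; ring
      rw [h3]
      refine (abs_sub _ _).trans ?_
      rw [abs_neg]
      exact add_le_add h2 h1
    have hpq : ∀ V, |ξ p V * ξ q V| ≤ M p * M q := fun V => by
      rw [abs_mul]
      exact mul_le_mul (hM p V) (hM q V) (abs_nonneg _) (hM0 p)
    have hE : |𝔼 V, ξ p V * ξ q V| ≤ M p * M q :=
      (abs_expect_le _ _).trans (expect_le univ_nonempty fun V _ => hpq V)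
    have hpq0 : 0 ≤ M p * M q := mul_nonneg (hM0 p) (hM0 q)
    have e1 : ‖𝔼 V, ((ξ p V * ξ q V : ℝ) : ℂ) *
        (exp (I * ((θ * W1 V : ℝ) : ℂ)) - exp (I * ((θ * W2 q V : ℝ) : ℂ)))‖ ≤
        M p * M q * (|θ| * ∑ r ∈ nbhd supp q, M r) := by
      refine norm_expect_le_const fun V => ?_
      rw [norm_mul, norm_real, Real.norm_eq_abs]
      refine mul_le_mul (hpq V) ?_ (norm_nonneg _) hpq0
      refine (norm_exp_I_mul_sub_exp_le _ _).trans ?_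
      rw [← mul_sub, abs_mul]
      gcongr
      exact hd1 V
    have e2 : ‖𝔼 V, (exp (I * ((θ * W2 q V : ℝ) : ℂ)) - exp (I * ((θ * W V : ℝ) : ℂ)))‖ ≤
        |θ| * ((∑ r ∈ N, M r) + ∑ r ∈ nbhd supp q, M r) := by
      refine norm_expect_le_const fun V => ?_
      refine (norm_exp_I_mul_sub_exp_le _ _).trans ?_
      rw [← mul_sub, abs_mul]
      gcongr
      exact hd2 V
    have e3 : ‖((𝔼 V, ξ p V * ξ q V : ℝ) : ℂ) * 𝔼 V, (exp (I * ((θ * W2 q V : ℝ) : ℂ)) -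
          exp (I * ((θ * W V : ℝ) : ℂ)))‖ ≤
        M p * M q * (|θ| * ((∑ r ∈ N, M r) + ∑ r ∈ nbhd supp q, M r)) := by
      rw [norm_mul, norm_real, Real.norm_eq_abs]
      exact mul_le_mul hE e2 (norm_nonneg _) hpq0
    rw [norm_mul, norm_mul, norm_I, one_mul, norm_real, Real.norm_eq_abs]
    calc _ ≤ |θ| * (M p * M q * (|θ| * ∑ r ∈ nbhd supp q, M r) +
          M p * M q * (|θ| * ((∑ r ∈ N, M r) + ∑ r ∈ nbhd supp q, M r))) :=
        mul_le_mul_of_nonneg_left ((norm_add_le _ _).trans (add_le_add e1 e3)) (abs_nonneg _)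
      _ = _ := by rw [← sq_abs θ]; ring
  refine (norm_add_le _ _).trans ?_
  rw [mul_add, mul_sum]
  exact add_le_add hb1 ((norm_sum_le _ _).trans (sum_le_sum hb2))

lemma norm_expect_sum_mul_exp_sub_le (hdep : ∀ p, DependsOn (ξ p) (supp p : Set ι))
    (hmean : ∀ p, 𝔼 V, ξ p V = 0) (hM : ∀ p V, |ξ p V| ≤ M p) (θ : ℝ) :
    ‖(𝔼 V, ((∑ q, ξ q V : ℝ) : ℂ) * exp (I * ((θ * ∑ q, ξ q V : ℝ) : ℂ))) -
        I * θ * ((𝔼 V, (∑ q, ξ q V) ^ 2 : ℝ) : ℂ) *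
          𝔼 V, exp (I * ((θ * ∑ q, ξ q V : ℝ) : ℂ))‖ ≤
      4 * θ ^ 2 * ∑ p, M p * (∑ q ∈ nbhd supp p, M q) ^ 2 := by
  have hvar : 𝔼 V, (∑ q, ξ q V) ^ 2 = ∑ p, ∑ q ∈ nbhd supp p, 𝔼 V, ξ p V * ξ q V := by
    simp_rw [sq, sum_mul_sum, expect_sum_comm]
    refine sum_congr rfl fun p _ => (sum_subset (subset_univ _) fun q _ hq => ?_).symm
    rw [mem_nbhd, not_not] at hq
    rw [expect_mul_eq_of_dependsOn (hdep p) (hdep q) (by exact_mod_cast hq), hmean, zero_mul]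
  have h1 : (𝔼 V, ((∑ q, ξ q V : ℝ) : ℂ) * exp (I * ((θ * ∑ q, ξ q V : ℝ) : ℂ))) -
        I * θ * ((𝔼 V, (∑ q, ξ q V) ^ 2 : ℝ) : ℂ) *
          𝔼 V, exp (I * ((θ * ∑ q, ξ q V : ℝ) : ℂ)) =
      ∑ p, ((𝔼 V, (ξ p V : ℂ) * exp (I * ((θ * ∑ q, ξ q V : ℝ) : ℂ))) -
        ∑ q ∈ nbhd supp p, I * θ * ((𝔼 V, ξ p V * ξ q V : ℝ) : ℂ) *
          𝔼 V, exp (I * ((θ * ∑ q, ξ q V : ℝ) : ℂ))) := by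
    rw [sum_sub_distrib, hvar, ← expect_sum_comm]
    congr 1
    · refine expect_congr rfl fun V _ => ?_
      rw [← sum_mul]
      push_cast
      rfl
    · push_cast
      simp_rw [mul_sum, sum_mul]
  rw [h1]
  refine (norm_sum_le _ _).trans <| (sum_le_sum fun p _ =>
    norm_expect_summand_mul_exp_sub_le hdep hmean hM θ p).trans ?_
  rw [← mul_sum, sum_add_distrib]
  have h2 : ∀ p, ∑ q ∈ nbhd supp p, M p * M q *
        ((∑ r ∈ nbhd supp p, M r) + 2 * ∑ r ∈ nbhd supp q, M r) =
      M p * (∑ q ∈ nbhd supp p, M q) ^ 2 +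
        2 * ∑ q ∈ nbhd supp p, M p * (M q * ∑ r ∈ nbhd supp q, M r) := by
    intro p
    have h : ∀ q, M p * M q * ((∑ r ∈ nbhd supp p, M r) + 2 * ∑ r ∈ nbhd supp q, M r) =
        M p * (∑ r ∈ nbhd supp p, M r) * M q + 2 * (M p * (M q * ∑ r ∈ nbhd supp q, M r)) :=
      fun q => by ring
    simp_rw [h]
    rw [sum_add_distrib, ← mul_sum, ← mul_sum]
    ring
  have h3 : ∑ p, ∑ q ∈ nbhd supp p, M p * (M q * ∑ r ∈ nbhd supp q, M r) =
      ∑ p, M p * (∑ q ∈ nbhd supp p, M q) ^ 2 := by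
    rw [sum_comm' (t' := univ) (s' := fun q => nbhd supp q) (by simp [mem_nbhd_comm])]
    refine sum_congr rfl fun q _ => ?_
    rw [← sum_mul]
    ring
  simp_rw [h2]
  rw [sum_add_distrib, ← mul_sum, h3]
  apply le_of_eq
  ring

/-- A quantitative central limit theorem for sums of bounded, centered, locally dependent
functions of independent coordinates, in terms of characteristic functions. -/
theorem norm_charFun_sub_gaussian_le (hdep : ∀ p, DependsOn (ξ p) (supp p : Set ι))
    (hmean : ∀ p, 𝔼 V, ξ p V = 0) (hM : ∀ p V, |ξ p V| ≤ M p) :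
    ‖(𝔼 V, exp (I * ((∑ q, ξ q V : ℝ) : ℂ))) -
        exp (((-((𝔼 V, (∑ q, ξ q V) ^ 2) / 2) : ℝ) : ℂ))‖ ≤
      4 * ∑ p, M p * (∑ q ∈ nbhd supp p, M q) ^ 2 := by
  have hM0 : ∀ p, 0 ≤ M p := fun p => (abs_nonneg _).trans (hM p (fun _ => Classical.arbitrary α))
  set Γ := ∑ p, M p * (∑ q ∈ nbhd supp p, M q) ^ 2 with hΓ
  have hΓ0 : 0 ≤ Γ := sum_nonneg fun p _ => mul_nonneg (hM0 p) (sq_nonneg _)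
  set W : (ι → α) → ℝ := fun V => ∑ q, ξ q V with hW
  set v : ℝ := 𝔼 V, W V ^ 2 with hv
  have hv0 : 0 ≤ v := expect_nonneg fun V _ => sq_nonneg _
  let φ : ℝ → ℂ := fun θ => 𝔼 V, exp (I * ((θ * W V : ℝ) : ℂ))
  let φ' : ℝ → ℂ := fun θ => 𝔼 V, (W V : ℂ) * exp (I * ((θ * W V : ℝ) : ℂ))
  have hφ : ∀ θ, HasDerivAt φ (I * φ' θ) θ := by
    intro θ
    have hs : ∀ V, HasDerivAt (fun θ : ℝ => exp (I * ((θ * W V : ℝ) : ℂ)))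
        (I * ((W V : ℂ) * exp (I * ((θ * W V : ℝ) : ℂ)))) θ := by
      intro V
      have h0 : HasDerivAt (fun s : ℝ => I * ((s * W V : ℝ) : ℂ)) (I * W V) θ := by
        push_cast
        simpa using ((Complex.ofRealCLM.hasDerivAt (x := θ)).mul_const (W V : ℂ)).const_mul I
      refine h0.cexp.congr_deriv ?_
      ring
    have h1 := HasDerivAt.fun_sum (u := univ) fun V _ => hs V
    have h2 := h1.div_const (Fintype.card (ι → α) : ℂ)
    simp only [φ, φ', Fintype.expect_eq_sum_div_card]
    exact h2.congr_deriv (by rw [← mul_sum, mul_div_assoc])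
  let g : ℝ → ℂ := fun θ => φ θ * exp (((θ ^ 2 * v / 2 : ℝ) : ℂ))
  have hg : ∀ θ, HasDerivAt g
      (I * (φ' θ - I * θ * v * φ θ) * exp (((θ ^ 2 * v / 2 : ℝ) : ℂ))) θ := by
    intro θ
    have h0 : HasDerivAt (fun s : ℝ => ((s ^ 2 * v / 2 : ℝ) : ℂ)) ((θ * v : ℝ) : ℂ) θ := by
      have : HasDerivAt (fun s : ℝ => s ^ 2 * v / 2) (θ * v) θ := by
        refine (((hasDerivAt_pow 2 θ).mul_const v).div_const 2).congr_deriv ?_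
        push_cast
        ring
      exact this.ofReal_comp
    refine ((hφ θ).mul h0.cexp).congr_deriv ?_
    push_cast
    linear_combination (θ * v * φ θ * exp ((θ ^ 2 * v / 2 : ℂ))) * I_sq
  have hbound := norm_image_sub_le_of_norm_deriv_le_segment_01' (f := g)
    (C := 4 * Γ * Real.exp (v / 2)) (fun s _ => (hg s).hasDerivWithinAt) ?_
  · have hg0 : g 0 = 1 := by simp [g, φ]
    have hg1 : g 1 = φ 1 * exp (((v / 2 : ℝ) : ℂ)) := by simp [g]
    have hφ1 : (𝔼 V, exp (I * (W V : ℂ))) = φ 1 := by simp [φ]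
    rw [hφ1]
    have hfac : φ 1 - exp (((-(v / 2) : ℝ) : ℂ)) = (g 1 - g 0) * exp (((-(v / 2) : ℝ) : ℂ)) := by
      rw [hg0, hg1, sub_mul, mul_assoc, ← exp_add]
      simp
    rw [hfac, norm_mul, ← ofReal_exp, norm_real, Real.norm_eq_abs, Real.abs_exp]
    calc _ ≤ 4 * Γ * Real.exp (v / 2) * Real.exp (-(v / 2)) := by gcongr
      _ = 4 * Γ := by rw [mul_assoc, ← Real.exp_add]; simp
  · intro θ hθ
    have h1 := norm_expect_sum_mul_exp_sub_le hdep hmean hM θ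
    rw [norm_mul, norm_mul, norm_I, one_mul, ← ofReal_exp, norm_real, Real.norm_eq_abs,
      Real.abs_exp]
    have hθ2 : θ ^ 2 ≤ 1 := by nlinarith [hθ.1, hθ.2]
    refine mul_le_mul (h1.trans ?_) ?_ (Real.exp_pos _).le (by positivity)
    · change 4 * θ ^ 2 * Γ ≤ 4 * Γ
      nlinarith
    · gcongr
      nlinarith

end LocalDependence

section GraphCounts

open Finset

variable {n ℓ : ℕ}

/-- The weights `D Gr a b` off the diagonal, and zero on it. -/
def offWeight (Gr : Finset (Sym2 (Node n ℓ))) (a b : Fin n) : ℝ :=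
  if a = b then 0 else (D Gr a b : ℝ)

/-- The within-individual edge counts, centred. -/
def diagWeight (Gr : Finset (Sym2 (Node n ℓ))) (a : Fin n) : ℝ :=
  (D Gr a a : ℝ) - ((Gin Gr).card : ℝ) / n

/-- The indicator of the labels smaller than `t`, centred by its average over the labels. -/
def cind {n : ℕ} (t : ℕ) (j : Fin n) : ℝ := (if (j : ℕ) < t then 1 else 0) - (t : ℝ) / n

/-- The centred quadratic statistic with weights `W`. -/
def quadStat (W : Fin n → Fin n → ℝ) (t : ℕ) (f : Fin n → Fin n) : ℝ :=
  (∑ a, ∑ b, W a b * (cind t (f a) * cind t (f b))) / 2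

/-- The centred linear statistic with weights `d`. -/
def linStat (d : Fin n → ℝ) (t : ℕ) (f : Fin n → Fin n) : ℝ := ∑ a, d a * cind t (f a)

lemma D_comm (Gr : Finset (Sym2 (Node n ℓ))) (a b : Fin n) : D Gr a b = D Gr b a := by
  simp only [D, Sym2.eq_swap]

lemma offWeight_comm (Gr : Finset (Sym2 (Node n ℓ))) (a b : Fin n) :
    offWeight Gr a b = offWeight Gr b a := by
  simp only [offWeight, D_comm Gr a b, eq_comm]

lemma offWeight_self (Gr : Finset (Sym2 (Node n ℓ))) (a : Fin n) : offWeight Gr a a = 0 := by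
  simp [offWeight]

lemma offWeight_nonneg (Gr : Finset (Sym2 (Node n ℓ))) (a b : Fin n) : 0 ≤ offWeight Gr a b := by
  unfold offWeight; split_ifs <;> positivity

lemma offWeight_le_sq (Gr : Finset (Sym2 (Node n ℓ))) (a b : Fin n) :
    offWeight Gr a b ≤ offWeight Gr a b ^ 2 := by
  unfold offWeight
  split_ifs
  · simp
  · exact_mod_cast Nat.le_self_pow two_ne_zero _

lemma sum_offWeight (Gr : Finset (Sym2 (Node n ℓ))) (a : Fin n) :
    ∑ b, offWeight Gr a b = (Ddeg Gr a : ℝ) := by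
  simp only [offWeight, Ddeg, sum_filter, Nat.cast_sum]
  refine sum_congr rfl fun b _ => ?_
  by_cases h : a = b
  · simp [h]
  · simp [h, Ne.symm h]

lemma sum_sum_ite_eq_mk {z : Sym2 (Fin n)} (hz : ¬ z.IsDiag) :
    ∑ a, ∑ b, (if z = s(a, b) then (1 : ℝ) else 0) = 2 := by
  induction z with | _ p q
  rw [Sym2.mk_isDiag_iff] at hz
  have : ∀ a b : Fin n, (if s(p, q) = s(a, b) then (1 : ℝ) else 0) =
      (if p = a then if q = b then 1 else 0 else 0) +
      (if q = a then if p = b then 1 else 0 else 0) := by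
    intro a b
    simp only [Sym2.eq_iff]
    split_ifs <;> grind
  simp only [this, sum_add_distrib]
  simp [sum_ite_eq]
  norm_num

lemma sum_sum_offWeight_mul (Gr : Finset (Sym2 (Node n ℓ))) (F : Sym2 (Fin n) → ℝ) :
    ∑ a, ∑ b, offWeight Gr a b * F s(a, b) = 2 * ∑ e ∈ Gout Gr, F (indPair e) := by
  have h : ∀ a b, offWeight Gr a b * F s(a, b) =
      ∑ e ∈ Gout Gr, F (indPair e) * (if indPair e = s(a, b) then 1 else 0) := by
    intro a b
    by_cases hab : a = b
    · subst hab
      rw [offWeight_self, zero_mul]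
      refine (sum_eq_zero fun e he => ?_).symm
      rw [if_neg, mul_zero]
      intro h
      exact (mem_filter.1 he).2 (by rw [h]; exact rfl)
    · have : ∀ e ∈ Gout Gr, F (indPair e) * (if indPair e = s(a, b) then 1 else 0) =
          (if indPair e = s(a, b) then F s(a, b) else 0) := by
        intro e _
        split_ifs with h <;> simp [h]
      rw [sum_congr rfl this, ← sum_filter, sum_const, nsmul_eq_mul, offWeight, if_neg hab]
      congr 2
      rw [D, Gout, filter_filter]
      congr 1
      refine filter_congr fun e _ => ⟨fun h => ⟨by rw [h]; simpa using hab, h⟩, fun h => h.2⟩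
  simp only [h]
  rw [sum_congr rfl fun a _ => sum_comm, sum_comm, mul_sum]
  refine sum_congr rfl fun e he => ?_
  simp only [← mul_sum]
  rw [sum_sum_ite_eq_mk (mem_filter.1 he).2, mul_comm]

lemma sum_D_self_mul (Gr : Finset (Sym2 (Node n ℓ))) (F : Sym2 (Fin n) → ℝ) :
    ∑ a, (D Gr a a : ℝ) * F s(a, a) = ∑ e ∈ Gin Gr, F (indPair e) := by
  have h : ∀ a, (D Gr a a : ℝ) * F s(a, a) =
      ∑ e ∈ Gin Gr, if indPair e = s(a, a) then F (indPair e) else 0 := by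
    intro a
    have : ∀ e ∈ Gin Gr, (if indPair e = s(a, a) then F (indPair e) else 0) =
          (if indPair e = s(a, a) then F s(a, a) else 0) := by
      intro e _
      split_ifs with h <;> simp [h]
    rw [sum_congr rfl this, ← sum_filter, sum_const, nsmul_eq_mul]
    congr 2
    rw [D, Gin, filter_filter]
    congr 1
    refine filter_congr fun e _ => ⟨fun h => ⟨by rw [h]; exact rfl, h⟩, fun h => h.2⟩
  simp only [h]
  rw [sum_comm]
  refine sum_congr rfl fun e he => ?_
  have hz := (mem_filter.1 he).2
  generalize indPair e = z at hz
  induction z with | _ p q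
  rw [Sym2.mk_isDiag_iff] at hz
  subst hz
  simp

lemma sum_Ddeg (Gr : Finset (Sym2 (Node n ℓ))) :
    ∑ a, (Ddeg Gr a : ℝ) = 2 * (Gout Gr).card := by
  have := sum_sum_offWeight_mul Gr fun _ => 1
  simpa [sum_offWeight] using this

lemma sum_D_self (Gr : Finset (Sym2 (Node n ℓ))) :
    ∑ a, (D Gr a a : ℝ) = (Gin Gr).card := by
  have := sum_D_self_mul Gr fun _ => 1
  simpa using this

lemma forall_mem_indPair {p : Fin n → Prop} (e : Sym2 (Node n ℓ)) :
    (∀ i ∈ indPair e, p i) ↔ ∀ x ∈ e, p x.1 := by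
  simp [indPair, Sym2.mem_map]

lemma card_filter_forall {p : Fin n → Prop} (A : Finset (Sym2 (Node n ℓ)))
    [DecidablePred fun e : Sym2 (Node n ℓ) => ∀ x ∈ e, p x.1]
    [DecidablePred fun z : Sym2 (Fin n) => ∀ i ∈ z, p i] :
    ((A.filter fun e => ∀ x ∈ e, p x.1).card : ℝ) =
      ∑ e ∈ A, if ∀ i ∈ indPair e, p i then 1 else 0 := by
  simp only [forall_mem_indPair, sum_boole]

lemma two_mul_Rout1 (Gr : Finset (Sym2 (Node n ℓ))) (t : ℕ) (σ : Equiv.Perm (Fin n)) :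
    2 * (Rout1 Gr t σ : ℝ) = ∑ a, ∑ b, offWeight Gr a b *
      ((cind t (σ a) + t / n) * (cind t (σ b) + t / n)) := by
  rw [Rout1, card_filter_forall (p := fun i => (σ i : ℕ) + 1 ≤ t),
    ← sum_sum_offWeight_mul Gr fun z => if ∀ i ∈ z, (σ i : ℕ) + 1 ≤ t then 1 else 0]
  refine sum_congr rfl fun a _ => sum_congr rfl fun b _ => ?_
  simp only [cind, sub_add_cancel, Sym2.mem_iff, forall_eq_or_imp, forall_eq, Nat.succ_le_iff,
    ite_and]
  split_ifs <;> simp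

lemma two_mul_Rout2 (Gr : Finset (Sym2 (Node n ℓ))) (t : ℕ) (σ : Equiv.Perm (Fin n)) :
    2 * (Rout2 Gr t σ : ℝ) = ∑ a, ∑ b, offWeight Gr a b *
      ((1 - (cind t (σ a) + t / n)) * (1 - (cind t (σ b) + t / n))) := by
  rw [Rout2, card_filter_forall (p := fun i => t ≤ (σ i : ℕ)),
    ← sum_sum_offWeight_mul Gr fun z => if ∀ i ∈ z, t ≤ (σ i : ℕ) then 1 else 0]
  refine sum_congr rfl fun a _ => sum_congr rfl fun b _ => ?_
  simp only [cind, sub_add_cancel, Sym2.mem_iff, forall_eq_or_imp, forall_eq, ← not_lt, ite_and]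
  split_ifs <;> simp

lemma Rin1_eq_sum (Gr : Finset (Sym2 (Node n ℓ))) (t : ℕ) (σ : Equiv.Perm (Fin n)) :
    (Rin1 Gr t σ : ℝ) = ∑ a, (D Gr a a : ℝ) * (cind t (σ a) + t / n) := by
  rw [Rin1, card_filter_forall (p := fun i => (σ i : ℕ) + 1 ≤ t),
    ← sum_D_self_mul Gr fun z => if ∀ i ∈ z, (σ i : ℕ) + 1 ≤ t then 1 else 0]
  refine sum_congr rfl fun a _ => ?_
  simp [cind, Sym2.mem_iff]

lemma sum_cind (hn : 0 < n) {t : ℕ} (ht : t ≤ n) : ∑ j : Fin n, cind t j = 0 := by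
  have h : ∑ j : Fin n, (if (j : ℕ) < t then (1 : ℝ) else 0) = t := by
    rw [Fin.sum_univ_eq_sum_range (fun j => if j < t then (1 : ℝ) else 0) n, sum_boole]
    congr 1
    rw [show (range n).filter (fun j => j < t) = range t by ext; simp; omega, card_range]
  have : (n : ℝ) ≠ 0 := by positivity
  simp only [cind, sum_sub_distrib, h]
  simp
  field_simp
  simp

lemma Rin1_eq_linStat (Gr : Finset (Sym2 (Node n ℓ))) (hn : 0 < n) {t : ℕ} (ht : t ≤ n)
    (σ : Equiv.Perm (Fin n)) :
    (Rin1 Gr t σ : ℝ) = linStat (diagWeight Gr) t σ + (Gin Gr).card * (t / n) := by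
  have h : ∑ a, cind t (σ a) = 0 := by rw [Equiv.sum_comp σ, sum_cind hn ht]
  rw [Rin1_eq_sum, linStat]
  simp only [diagWeight, mul_add, sub_mul, sum_add_distrib, sum_sub_distrib, ← mul_sum, ← sum_mul,
    h, sum_D_self]
  ring

lemma sum_sum_offWeight_left (Gr : Finset (Sym2 (Node n ℓ))) (g : Fin n → ℝ) :
    ∑ a, ∑ b, offWeight Gr a b * g a = ∑ a, (Ddeg Gr a : ℝ) * g a := by
  simp only [← sum_mul, sum_offWeight]

lemma sum_sum_offWeight_right (Gr : Finset (Sym2 (Node n ℓ))) (g : Fin n → ℝ) :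
    ∑ a, ∑ b, offWeight Gr a b * g b = ∑ a, (Ddeg Gr a : ℝ) * g a := by
  rw [sum_comm, ← sum_sum_offWeight_left]
  simp only [offWeight_comm Gr]

lemma Routw_eq_quadStat (Gr : Finset (Sym2 (Node n ℓ))) (hn : 2 < n) (t : ℕ)
    (σ : Equiv.Perm (Fin n)) :
    Routw Gr t σ = quadStat (offWeight Gr) t σ -
      (((t : ℝ) - 1) / (n - 2) - t / n) * linStat (fun a => (Ddeg Gr a : ℝ)) t σ +
      ((t / n : ℝ) ^ 2 + ((t : ℝ) - 1) / (n - 2) - 2 * (((t : ℝ) - 1) / (n - 2)) * (t / n)) *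
        (Gout Gr).card := by
  have hn2 : (n : ℝ) - 2 ≠ 0 := by
    have : (2 : ℝ) < n := by exact_mod_cast hn
    linarith
  have key : ∀ α β : ℝ, ∑ a, ∑ b, offWeight Gr a b *
      ((α + β * cind t (σ a)) * (α + β * cind t (σ b))) =
      2 * (α ^ 2 * (Gout Gr).card + α * β * linStat (fun a => (Ddeg Gr a : ℝ)) t σ +
        β ^ 2 * quadStat (offWeight Gr) t σ) := by
    intro α β
    have e : ∀ a b, offWeight Gr a b * ((α + β * cind t (σ a)) * (α + β * cind t (σ b))) =
      α ^ 2 * (offWeight Gr a b * (1 : ℝ)) + α * β * (offWeight Gr a b * cind t (σ a)) +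
      α * β * (offWeight Gr a b * cind t (σ b)) +
      β ^ 2 * (offWeight Gr a b * (cind t (σ a) * cind t (σ b))) := fun a b => by ring
    simp only [e, sum_add_distrib, ← mul_sum]
    rw [sum_sum_offWeight_left Gr fun a => cind t (σ a),
      sum_sum_offWeight_right Gr fun a => cind t (σ a), sum_sum_offWeight_left Gr fun _ => 1]
    simp only [mul_one, sum_Ddeg, quadStat, linStat]
    ring
  have h1 : (Rout1 Gr t σ : ℝ) = (t / n : ℝ) ^ 2 * (Gout Gr).card +
      (t / n : ℝ) * linStat (fun a => (Ddeg Gr a : ℝ)) t σ + quadStat (offWeight Gr) t σ := by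
    have := two_mul_Rout1 Gr t σ
    have k := key (t / n) 1
    simp only [one_mul, add_comm (t / n : ℝ)] at k
    rw [k] at this
    linarith
  have h2 : (Rout2 Gr t σ : ℝ) = (1 - t / n : ℝ) ^ 2 * (Gout Gr).card -
      (1 - t / n : ℝ) * linStat (fun a => (Ddeg Gr a : ℝ)) t σ + quadStat (offWeight Gr) t σ := by
    have := two_mul_Rout2 Gr t σ
    have k := key (1 - t / n) (-1)
    have e : ∀ x : ℝ, 1 - (x + t / n) = 1 - t / n + -1 * x := fun x => by ring
    simp only [e] at this
    rw [k] at this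
    linarith
  rw [Routw, h1, h2]
  have e : (n : ℝ) - t - 1 = (n - 2) - (t - 1) := by ring
  rw [e]
  field_simp
  ring

lemma D_self_le (Gr : Finset (Sym2 (Node n ℓ))) (a : Fin n) : D Gr a a ≤ ℓ ^ 2 := by
  have h : (Gr.filter fun e => indPair e = s(a, a)) ⊆
      (univ : Finset (Fin ℓ × Fin ℓ)).image fun p => s((a, p.1), (a, p.2)) := by
    intro e he
    have he := (mem_filter.1 he).2
    induction e with | _ x y
    obtain ⟨x1, x2⟩ := x
    obtain ⟨y1, y2⟩ := y
    simp only [indPair, Sym2.map_mk, Sym2.eq_iff, or_self] at he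
    obtain ⟨rfl, rfl⟩ := he
    exact mem_image.2 ⟨(x2, y2), mem_univ _, rfl⟩
  refine (card_le_card h).trans (card_image_le.trans ?_)
  simp [sq]

lemma abs_diagWeight_le (Gr : Finset (Sym2 (Node n ℓ))) (hn : 0 < n) (a : Fin n) :
    |diagWeight Gr a| ≤ (ℓ : ℝ) ^ 2 := by
  have hb : ∀ a, (D Gr a a : ℝ) ≤ (ℓ : ℝ) ^ 2 := fun a => by exact_mod_cast D_self_le Gr a
  have h : ((Gin Gr).card : ℝ) / n ≤ (ℓ : ℝ) ^ 2 := by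
    rw [← sum_D_self, div_le_iff₀ (by positivity)]
    refine (sum_le_sum fun a _ => hb a).trans ?_
    simp [mul_comm]
  rw [abs_le, diagWeight]
  have h0 : 0 ≤ ((Gin Gr).card : ℝ) / n := by positivity
  have h1 : (0 : ℝ) ≤ D Gr a a := by positivity
  constructor <;> linarith [hb a]

lemma sum_diagWeight (Gr : Finset (Sym2 (Node n ℓ))) (hn : 0 < n) :
    ∑ a, diagWeight Gr a = 0 := by
  have : (n : ℝ) ≠ 0 := by positivity
  simp only [diagWeight, sum_sub_distrib, sum_D_self]
  simp
  field_simp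
  simp

lemma sum_diagWeight_sq (Gr : Finset (Sym2 (Node n ℓ))) (hn : 0 < n) :
    ∑ a, diagWeight Gr a ^ 2 = ∑ a, (D Gr a a : ℝ) ^ 2 - ((Gin Gr).card : ℝ) ^ 2 / n := by
  have : (n : ℝ) ≠ 0 := by positivity
  simp only [diagWeight, sub_sq, sum_sub_distrib, sum_add_distrib, ← mul_sum, ← sum_mul, sum_D_self]
  simp
  field_simp
  ring

lemma Ddeg_eq_card (Gr : Finset (Sym2 (Node n ℓ))) (u : Fin n) :
    (Ddeg Gr u : ℝ) = ((Gout Gr).filter fun e => u ∈ indPair e).card := by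
  have h := sum_sum_offWeight_mul Gr fun z => if u ∈ z then 1 else 0
  have e : ∀ a b, offWeight Gr a b * (if u ∈ s(a, b) then 1 else 0) =
      offWeight Gr a b * (if a = u then 1 else 0) +
        offWeight Gr a b * (if b = u then 1 else 0) := by
    intro a b
    simp only [Sym2.mem_iff]
    by_cases hab : a = b
    · simp [hab, offWeight_self]
    · split_ifs <;> grind
  simp only [e, sum_add_distrib] at h
  rw [sum_sum_offWeight_left Gr fun a => if a = u then 1 else 0,
    sum_sum_offWeight_right Gr fun a => if a = u then 1 else 0] at h
  simp only [mul_ite, mul_one, mul_zero, sum_ite_eq', mem_univ, if_true, sum_boole] at h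
  linarith

lemma filter_mem_indPair_subset_Ae (Gr : Finset (Sym2 (Node n ℓ))) {e : Sym2 (Node n ℓ)}
    (he : e ∈ Gout Gr) {u : Fin n} (hu : u ∈ indPair e) :
    ((Gout Gr).filter fun e => u ∈ indPair e) ⊆ Ae Gr e := by
  intro e' he'
  rw [mem_filter] at he'
  rw [Ae, if_neg (mem_filter.1 he).2, mem_filter]
  refine ⟨he'.1, ?_⟩
  obtain ⟨x, hx, hxu⟩ := Sym2.mem_map.1 hu
  obtain ⟨y, hy, hyu⟩ := Sym2.mem_map.1 he'.2
  exact ⟨y, hy, x, hx, hyu.trans hxu.symm⟩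

lemma Ddeg_sq_le_card_mul_card (Gr : Finset (Sym2 (Node n ℓ))) {e : Sym2 (Node n ℓ)}
    (he : e ∈ Gout Gr) {u : Fin n} (hu : u ∈ indPair e) :
    (Ddeg Gr u : ℝ) ^ 2 ≤ ((Ae Gr e).card : ℝ) * (Be Gr e).card := by
  have hA : (Ddeg Gr u : ℝ) ≤ (Ae Gr e).card := by
    rw [Ddeg_eq_card]
    exact_mod_cast card_le_card (filter_mem_indPair_subset_Ae Gr he hu)
  have hmem : e ∈ Ae Gr e :=
    filter_mem_indPair_subset_Ae Gr he hu (mem_filter.2 ⟨he, hu⟩)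
  have hB : ((Ae Gr e).card : ℝ) ≤ (Be Gr e).card := by
    exact_mod_cast card_le_card (subset_biUnion_of_mem (fun e' => Ae Gr e') hmem)
  rw [sq]
  have h0 : (0 : ℝ) ≤ Ddeg Gr u := by positivity
  exact mul_le_mul hA (hA.trans hB) h0 (by positivity)

lemma sum_Ddeg_cube_le (Gr : Finset (Sym2 (Node n ℓ))) :
    ∑ a, (Ddeg Gr a : ℝ) ^ 3 ≤ 2 * ∑ e ∈ Gout Gr, ((Ae Gr e).card : ℝ) * (Be Gr e).card := by
  have h : ∀ a, (Ddeg Gr a : ℝ) ^ 3 =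
      ∑ e ∈ Gout Gr, if a ∈ indPair e then (Ddeg Gr a : ℝ) ^ 2 else 0 := by
    intro a
    rw [← sum_filter, sum_const, nsmul_eq_mul, ← Ddeg_eq_card]
    ring
  simp only [h]
  rw [sum_comm, mul_sum]
  refine sum_le_sum fun e he => ?_
  have h2 : ∑ a, (if a ∈ indPair e then (Ddeg Gr a : ℝ) ^ 2 else 0) ≤
      ∑ a, if a ∈ indPair e then ((Ae Gr e).card : ℝ) * (Be Gr e).card else 0 := by
    refine sum_le_sum fun a _ => ?_
    split_ifs with ha
    · exact Ddeg_sq_le_card_mul_card Gr he ha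
    · exact le_rfl
  refine h2.trans ?_
  rw [← sum_filter, sum_const, nsmul_eq_mul]
  refine mul_le_mul_of_nonneg_right ?_ (by positivity)
  generalize indPair e = z
  induction z with | _ p q
  have : (univ.filter fun a => a ∈ s(p, q)) ⊆ {p, q} := by
    intro a
    simp
  exact_mod_cast (card_le_card this).trans card_le_two

lemma card_Gout_le (Gr : Finset (Sym2 (Node n ℓ))) :
    ((Gout Gr).card : ℝ) ≤ (∑ a, ∑ b, offWeight Gr a b ^ 2) / 2 := by
  have h := sum_Ddeg Gr
  simp only [← sum_offWeight] at h
  have := sum_le_sum fun a (_ : a ∈ univ) => sum_le_sum fun b (_ : b ∈ univ) =>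
    offWeight_le_sq Gr a b
  linarith

end GraphCounts

section PermutationMoments

open Finset

variable {n : ℕ}

lemma sub_card_mul_expect_perm {T : Finset (Fin n)} {a : Fin n} (ha : a ∉ T) (s : Fin n → ℝ)
    {G : Equiv.Perm (Fin n) → ℝ} (hG : ∀ σ τ, (∀ b ∈ T, σ b = τ b) → G σ = G τ) :
    ((n : ℝ) - T.card) * 𝔼 σ : Equiv.Perm (Fin n), s (σ a) * G σ =
      𝔼 σ : Equiv.Perm (Fin n), ((∑ j, s j) - ∑ b ∈ T, s (σ b)) * G σ := by
  have h1 : ∀ a' ∈ Tᶜ, 𝔼 σ : Equiv.Perm (Fin n), s (σ a') * G σ =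
      𝔼 σ : Equiv.Perm (Fin n), s (σ a) * G σ := by
    intro a' ha'
    refine (Fintype.expect_equiv (Equiv.mulRight (Equiv.swap a a')) _ _ fun σ => ?_).symm
    rw [mem_compl] at ha'
    have : G (Equiv.mulRight (Equiv.swap a a') σ) = G σ := hG _ _ fun b hb => by
      have hba : b ≠ a := fun h => ha (h ▸ hb)
      have hba' : b ≠ a' := fun h => ha' (h ▸ hb)
      simp [Equiv.swap_apply_of_ne_of_ne hba hba']
    rw [this]
    simp
  have h2 : ∀ σ : Equiv.Perm (Fin n),
      (∑ j, s j) - ∑ b ∈ T, s (σ b) = ∑ a' ∈ Tᶜ, s (σ a') := by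
    intro σ
    rw [← Equiv.sum_comp σ, ← sum_add_sum_compl T]
    ring
  have hc : ((n : ℝ) - T.card) = (Tᶜ.card : ℝ) := by
    rw [card_compl, Fintype.card_fin, Nat.cast_sub (by simpa using card_le_univ T)]
  simp only [h2, sum_mul, expect_sum_comm]
  rw [sum_congr rfl h1, sum_const, nsmul_eq_mul, hc]

lemma mul_expect_perm_apply (s : Fin n → ℝ) (a : Fin n) :
    (n : ℝ) * 𝔼 σ : Equiv.Perm (Fin n), s (σ a) = ∑ j, s j := by
  have := sub_card_mul_expect_perm (notMem_empty a) s (G := fun _ => 1) fun _ _ _ => rfl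
  simpa using this

lemma sub_one_mul_expect_perm_apply_mul {a b : Fin n} (hab : a ≠ b) (s g : Fin n → ℝ) :
    ((n : ℝ) - 1) * 𝔼 σ : Equiv.Perm (Fin n), s (σ a) * g (σ b) =
      𝔼 σ : Equiv.Perm (Fin n), ((∑ j, s j) - s (σ b)) * g (σ b) := by
  have := sub_card_mul_expect_perm (T := {b}) (by simpa using hab) s
    (G := fun σ => g (σ b)) fun σ τ h => by simp [h b (mem_singleton_self b)]
  simpa using this

lemma expect_perm_sum_mul_sq (hn : 2 ≤ n) (d g : Fin n → ℝ) :
    𝔼 σ : Equiv.Perm (Fin n), (∑ a, d a * g (σ a)) ^ 2 =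
      (∑ a, d a ^ 2) * ((∑ j, g j ^ 2) / n) +
        ((∑ a, d a) ^ 2 - ∑ a, d a ^ 2) *
          (((∑ j, g j) ^ 2 - ∑ j, g j ^ 2) / (n * (n - 1))) := by
  have hn' : (2 : ℝ) ≤ n := by exact_mod_cast hn
  have hn0 : (n : ℝ) ≠ 0 := by linarith
  have hn1 : (n : ℝ) - 1 ≠ 0 := by linarith
  have h1 : ∀ a, 𝔼 σ : Equiv.Perm (Fin n), g (σ a) * g (σ a) = (∑ j, g j ^ 2) / n := by
    intro a
    rw [eq_div_iff hn0, mul_comm, mul_expect_perm_apply (fun j => g j * g j) a]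
    simp only [sq]
  have h2 : ∀ a b, a ≠ b → 𝔼 σ : Equiv.Perm (Fin n), g (σ a) * g (σ b) =
      ((∑ j, g j) ^ 2 - ∑ j, g j ^ 2) / (n * (n - 1)) := by
    intro a b hab
    have h := sub_one_mul_expect_perm_apply_mul hab g g
    simp only [sub_mul, expect_sub_distrib, ← mul_expect, h1] at h
    have h' := mul_expect_perm_apply g b
    rw [eq_div_iff (by positivity)]
    have : (n : ℝ) * ((∑ j, g j ^ 2) / n) = ∑ j, g j ^ 2 := by field_simp
    linear_combination (n : ℝ) * h + (∑ j, g j) * h' - this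
  have h3 : ∀ a b, 𝔼 σ : Equiv.Perm (Fin n), (d a * g (σ a)) * (d b * g (σ b)) =
      d a * d b * (((∑ j, g j) ^ 2 - ∑ j, g j ^ 2) / (n * (n - 1))) +
      if a = b then d a ^ 2 * ((∑ j, g j ^ 2) / n -
        ((∑ j, g j) ^ 2 - ∑ j, g j ^ 2) / (n * (n - 1))) else 0 := by
    intro a b
    simp only [mul_mul_mul_comm (d a), ← mul_expect]
    split_ifs with hab
    · subst hab
      rw [h1]
      ring
    · rw [h2 a b hab]
      ring
  simp only [sq (∑ a, d a * g _), sum_mul_sum]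
  simp only [expect_sum_comm, h3, sum_add_distrib, sum_ite_eq, mem_univ, if_true, ← sum_mul]
  rw [← sum_mul_sum]
  ring

lemma expect_perm_sum_mul_sq_le_of_sum_left (hn : 2 ≤ n) {d : Fin n → ℝ} (hd : ∑ a, d a = 0)
    (g : Fin n → ℝ) :
    𝔼 σ : Equiv.Perm (Fin n), (∑ a, d a * g (σ a)) ^ 2 ≤
      2 * (∑ a, d a ^ 2) * ((∑ j, g j ^ 2) / n) := by
  have hn' : (2 : ℝ) ≤ n := by exact_mod_cast hn
  rw [expect_perm_sum_mul_sq hn, hd]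
  have hS : 0 ≤ ∑ a, d a ^ 2 := sum_nonneg fun _ _ => sq_nonneg _
  have hg : 0 ≤ ∑ a, g a ^ 2 := sum_nonneg fun _ _ => sq_nonneg _
  have h : -(((∑ j, g j) ^ 2 - ∑ j, g j ^ 2) / (n * (n - 1))) ≤ (∑ j, g j ^ 2) / n := by
    rw [← neg_div, div_le_div_iff₀ (by nlinarith) (by linarith)]
    nlinarith [sq_nonneg (∑ j, g j), mul_nonneg hg (by nlinarith : (0:ℝ) ≤ n * (n - 2)),
      mul_nonneg (sq_nonneg (∑ j, g j)) (by linarith : (0:ℝ) ≤ n)]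
  nlinarith [mul_le_mul_of_nonneg_left h hS]

lemma expect_perm_sum_mul_sq_le_of_sum_right (hn : 2 ≤ n) {d : Fin n → ℝ} (hd : ∀ a, 0 ≤ d a)
    {g : Fin n → ℝ} (hg : ∑ j, g j = 0) :
    𝔼 σ : Equiv.Perm (Fin n), (∑ a, d a * g (σ a)) ^ 2 ≤
      (∑ a, d a ^ 2) * ((∑ j, g j ^ 2) / n) := by
  have hn' : (2 : ℝ) ≤ n := by exact_mod_cast hn
  rw [expect_perm_sum_mul_sq hn, hg]
  have hg : 0 ≤ ∑ a, g a ^ 2 := sum_nonneg fun _ _ => sq_nonneg _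
  have h1 : 0 ≤ (∑ a, d a) ^ 2 - ∑ a, d a ^ 2 :=
    sub_nonneg.2 (sum_sq_le_sq_sum_of_nonneg fun a _ => hd a)
  have h2 : 0 ≤ (∑ a, g a ^ 2) / (n * (n - 1)) := div_nonneg hg (by nlinarith)
  have : ((0 : ℝ) ^ 2 - ∑ j, g j ^ 2) / (n * (n - 1)) = -((∑ a, g a ^ 2) / (n * (n - 1))) := by
    ring
  rw [this]
  nlinarith

lemma expect_perm_abs_mul_le {b d : Fin n} (hbd : b ≠ d) (δ : Fin n → ℝ) :
    (n : ℝ) * ((n : ℝ) - 1) * 𝔼 σ : Equiv.Perm (Fin n), |δ (σ b)| * |δ (σ d)| ≤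
      (∑ j, |δ j|) ^ 2 := by
  rw [mul_assoc, sub_one_mul_expect_perm_apply_mul hbd (fun j => |δ j|) fun j => |δ j|]
  have : 𝔼 σ : Equiv.Perm (Fin n), ((∑ j, |δ j|) - |δ (σ d)|) * |δ (σ d)| ≤
      𝔼 σ : Equiv.Perm (Fin n), (∑ j, |δ j|) * |δ (σ d)| :=
    expect_le_expect fun σ _ => by nlinarith [abs_nonneg (δ (σ d))]
  rw [← mul_expect] at this
  have h := mul_expect_perm_apply (fun j => |δ j|) d
  calc _ ≤ (n : ℝ) * ((∑ j, |δ j|) * 𝔼 σ : Equiv.Perm (Fin n), |δ (σ d)|) := by gcongr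
    _ = _ := by rw [mul_left_comm, h, sq]

lemma abs_expect_perm_four_le {a b c d : Fin n} (hab : a ≠ b) (hac : a ≠ c) (had : a ≠ d)
    (hbd : b ≠ d) (hn : 4 ≤ n) {s δ : Fin n → ℝ} (hs : ∀ j, |s j| ≤ 2)
    (hsum : |∑ j, s j| ≤ ∑ j, |δ j|) :
    |𝔼 σ : Equiv.Perm (Fin n), s (σ a) * δ (σ b) * (s (σ c) * δ (σ d))| ≤
      2 * ((∑ j, |δ j|) + 6) * (∑ j, |δ j|) ^ 2 / (n * (n - 1) * (n - 3)) := by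
  have hn' : (4 : ℝ) ≤ n := by exact_mod_cast hn
  have hΔ : 0 ≤ ∑ j, |δ j| := sum_nonneg fun _ _ => abs_nonneg _
  have hcard : ((({b, c, d} : Finset (Fin n)).card : ℕ) : ℝ) ≤ 3 := by
    exact_mod_cast card_le_three
  have h := sub_card_mul_expect_perm (T := {b, c, d}) (a := a) (by simp [hab, hac, had]) s
    (G := fun σ => δ (σ b) * s (σ c) * δ (σ d)) fun σ τ h => by
      rw [h b (by simp), h c (by simp), h d (by simp)]
  have h2 : |𝔼 σ : Equiv.Perm (Fin n), ((∑ j, s j) - ∑ b ∈ {b, c, d}, s (σ b)) *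
      (δ (σ b) * s (σ c) * δ (σ d))| ≤
      𝔼 σ : Equiv.Perm (Fin n), (2 * ((∑ j, |δ j|) + 6)) * (|δ (σ b)| * |δ (σ d)|) := by
    refine (abs_expect_le _ _).trans (expect_le_expect fun σ _ => ?_)
    have h3 : |∑ b ∈ {b, c, d}, s (σ b)| ≤ 6 := by
      refine (abs_sum_le_sum_abs _ _).trans ((sum_le_sum fun b _ => hs (σ b)).trans ?_)
      rw [sum_const, nsmul_eq_mul]
      linarith
    have h4 : |(∑ j, s j) - ∑ b ∈ {b, c, d}, s (σ b)| ≤ (∑ j, |δ j|) + 6 :=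
      (abs_sub _ _).trans (add_le_add hsum h3)
    rw [abs_mul, abs_mul, abs_mul]
    calc _ ≤ ((∑ j, |δ j|) + 6) * (|δ (σ b)| * 2 * |δ (σ d)|) := by
          gcongr
          exact hs _
      _ = _ := by ring
  rw [← mul_expect] at h2
  have h5 := expect_perm_abs_mul_le hbd δ
  have e : ∀ σ : Equiv.Perm (Fin n), s (σ a) * δ (σ b) * (s (σ c) * δ (σ d)) =
    s (σ a) * (δ (σ b) * s (σ c) * δ (σ d)) := fun σ => by ring
  simp only [e]
  rw [← h, abs_mul] at h2
  rw [le_div_iff₀ (mul_pos (by nlinarith) (by linarith))]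
  set X := |𝔼 σ : Equiv.Perm (Fin n), s (σ a) * (δ (σ b) * s (σ c) * δ (σ d))|
  have h6 : ((n : ℝ) - 3) * X ≤
      |(n : ℝ) - ((({b, c, d} : Finset (Fin n)).card : ℕ) : ℝ)| * X :=
    mul_le_mul_of_nonneg_right ((by linarith : (n : ℝ) - 3 ≤ _).trans (le_abs_self _))
      (abs_nonneg _)
  have hnn : 0 ≤ (n : ℝ) * (n - 1) := by nlinarith
  calc X * (n * (n - 1) * (n - 3)) = n * (n - 1) * ((n - 3) * X) := by ring
    _ ≤ n * (n - 1) * (2 * ((∑ j, |δ j|) + 6) *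
        𝔼 σ : Equiv.Perm (Fin n), |δ (σ b)| * |δ (σ d)|) :=
        mul_le_mul_of_nonneg_left (h6.trans h2) hnn
    _ = 2 * ((∑ j, |δ j|) + 6) *
        (n * (n - 1) * 𝔼 σ : Equiv.Perm (Fin n), |δ (σ b)| * |δ (σ d)|) := by ring
    _ ≤ _ := mul_le_mul_of_nonneg_left h5 (by linarith)

lemma expect_perm_quadratic_sq_le (hn : 4 ≤ n) {W : Fin n → Fin n → ℝ}
    (hW : ∀ a b, 0 ≤ W a b) (hsymm : ∀ a b, W a b = W b a) (hdiag : ∀ a, W a a = 0)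
    {s δ : Fin n → ℝ} (hs : ∀ j, |s j| ≤ 2) (hδ : ∀ j, |δ j| ≤ 1)
    (hsum : |∑ j, s j| ≤ ∑ j, |δ j|) :
    𝔼 σ : Equiv.Perm (Fin n), (∑ a, ∑ b, W a b * (s (σ a) * δ (σ b))) ^ 2 ≤
      16 * ((∑ j, |δ j|) / n) * ∑ a, (∑ b, W a b) ^ 2 +
        (∑ a, ∑ b, W a b) ^ 2 *
          (2 * ((∑ j, |δ j|) + 6) * (∑ j, |δ j|) ^ 2 / (n * (n - 1) * (n - 3))) := by
  have hn' : (4 : ℝ) ≤ n := by exact_mod_cast hn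
  set Δ := ∑ j, |δ j| with hΔdef
  have hΔ : 0 ≤ Δ := sum_nonneg fun _ _ => abs_nonneg _
  set K := 2 * (Δ + 6) * Δ ^ 2 / (n * (n - 1) * (n - 3)) with hK
  have hK0 : 0 ≤ K := by
    have h1 : (0 : ℝ) ≤ n - 1 := by linarith
    have h3 : (0 : ℝ) ≤ n - 3 := by linarith
    positivity
  have hΔn : 0 ≤ 4 * (Δ / n) := by positivity
  have key : ∀ a b c d, a ≠ b → c ≠ d →
      𝔼 σ : Equiv.Perm (Fin n), s (σ a) * δ (σ b) * (s (σ c) * δ (σ d)) ≤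
      K + 4 * (Δ / n) * ((if a = c then 1 else 0) + (if a = d then 1 else 0) +
        (if b = c then 1 else 0) + (if b = d then 1 else 0)) := by
    intro a b c d hab hcd
    by_cases hdis : a ≠ c ∧ a ≠ d ∧ b ≠ d
    · obtain ⟨hac, had, hbd⟩ := hdis
      have := (le_abs_self _).trans (abs_expect_perm_four_le hab hac had hbd hn hs hsum)
      refine this.trans (le_add_of_nonneg_right (mul_nonneg hΔn ?_))
      positivity
    · have h1 : 𝔼 σ : Equiv.Perm (Fin n), s (σ a) * δ (σ b) * (s (σ c) * δ (σ d)) ≤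
          4 * (Δ / n) := by
        have h := mul_expect_perm_apply (fun j => |δ j|) b
        rw [← hΔdef, mul_comm, ← eq_div_iff (by linarith)] at h
        rw [← h, mul_expect]
        refine expect_le_expect fun σ _ => (le_abs_self _).trans ?_
        rw [abs_mul, abs_mul, abs_mul]
        calc _ ≤ 2 * |δ (σ b)| * (2 * 1) := by
              gcongr
              exacts [hs _, hs _, hδ _]
          _ = _ := by ring
      refine h1.trans ?_
      have h2 : (1 : ℝ) ≤ (if a = c then 1 else 0) + (if a = d then 1 else 0) +
        (if b = c then 1 else 0) + (if b = d then 1 else 0) := by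
        split_ifs <;> first | (exfalso; grind) | norm_num
      nlinarith [mul_le_mul_of_nonneg_left h2 hΔn]
  have expand : 𝔼 σ : Equiv.Perm (Fin n), (∑ a, ∑ b, W a b * (s (σ a) * δ (σ b))) ^ 2 =
      ∑ a, ∑ b, ∑ c, ∑ d, W a b * W c d *
        𝔼 σ : Equiv.Perm (Fin n), s (σ a) * δ (σ b) * (s (σ c) * δ (σ d)) := by
    simp only [sq, sum_mul]
    simp only [mul_sum, expect_sum_comm, mul_expect]
    simp only [mul_mul_mul_comm (W _ _)]
  rw [expand]
  have bound : ∀ a b c d, W a b * W c d *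
      𝔼 σ : Equiv.Perm (Fin n), s (σ a) * δ (σ b) * (s (σ c) * δ (σ d)) ≤
      W a b * W c d * (K + 4 * (Δ / n) * ((if a = c then 1 else 0) + (if a = d then 1 else 0) +
        (if b = c then 1 else 0) + (if b = d then 1 else 0))) := by
    intro a b c d
    by_cases hab : a = b
    · simp [hab, hdiag]
    by_cases hcd : c = d
    · simp [hcd, hdiag]
    exact mul_le_mul_of_nonneg_left (key a b c d hab hcd) (mul_nonneg (hW _ _) (hW _ _))
  refine (sum_le_sum fun a _ => sum_le_sum fun b _ => sum_le_sum fun c _ => sum_le_sum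
    fun d _ => bound a b c d).trans (le_of_eq ?_)
  set E : Fin n → ℝ := fun a => ∑ b, W a b with hE
  have left : ∀ φ : Fin n → ℝ, ∑ c, ∑ d, W c d * φ c = ∑ c, E c * φ c := fun φ => by
    simp only [hE, sum_mul]
  have right : ∀ φ : Fin n → ℝ, ∑ c, ∑ d, W c d * φ d = ∑ c, E c * φ c := fun φ => by
    rw [sum_comm, ← left]
    simp only [hsymm]
  have inner : ∀ a b, ∑ c, ∑ d, W a b * W c d * (K + 4 * (Δ / n) *
      ((if a = c then 1 else 0) + (if a = d then 1 else 0) +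
        (if b = c then 1 else 0) + (if b = d then 1 else 0))) =
      K * (∑ c, ∑ d, W c d) * W a b + 8 * (Δ / n) * (W a b * E a + W a b * E b) := by
    intro a b
    have e : ∀ c d, W a b * W c d * (K + 4 * (Δ / n) *
      ((if a = c then 1 else 0) + (if a = d then 1 else 0) +
        (if b = c then 1 else 0) + (if b = d then 1 else 0))) =
      W a b * (K * W c d + 4 * (Δ / n) * (W c d * (if a = c then 1 else 0) +
        W c d * (if a = d then 1 else 0) + W c d * (if b = c then 1 else 0) +
        W c d * (if b = d then 1 else 0))) := fun c d => by ring
    simp only [e, ← mul_sum, sum_add_distrib]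
    rw [left fun c => if a = c then 1 else 0, right fun c => if a = c then 1 else 0,
      left fun c => if b = c then 1 else 0, right fun c => if b = c then 1 else 0]
    simp only [mul_ite, mul_one, mul_zero, sum_ite_eq, mem_univ, if_true]
    ring
  simp only [inner, sum_add_distrib, ← mul_sum]
  rw [left, right]
  simp only [← sq]
  ring

end PermutationMoments

section IndependentLabels

open Finset

variable {ι α : Type*} [Fintype ι] [DecidableEq ι] [Fintype α] [Nonempty α]

lemma expect_apply_eq (g : α → ℝ) (a : ι) : 𝔼 V : ι → α, g (V a) = 𝔼 v, g v := by
  rw [Fintype.expect_equiv (Equiv.funSplitAt a α) (fun V => g (V a)) (fun p => g p.1)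
    fun V => rfl, ← univ_product_univ, expect_product]
  simp

lemma dependsOn_apply {ι α : Type*} (g : α → ℝ) (a : ι) :
    DependsOn (fun V : ι → α => g (V a)) {a} :=
  fun V V' h => by simp [h a rfl]

lemma expect_apply_mul_eq_zero {g : α → ℝ} (hg : 𝔼 v, g v = 0) {a : ι} {s : Set ι}
    {G : (ι → α) → ℝ} (hG : DependsOn G s) (ha : a ∉ s) : 𝔼 V, g (V a) * G V = 0 := by
  rw [expect_mul_eq_of_dependsOn (dependsOn_apply g a) hG (by simpa using ha),
    expect_apply_eq, hg, zero_mul]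

lemma dependsOn_sum_apply {ι α : Type*} (g : α → ℝ) (T : Finset ι) (p : ℕ) :
    DependsOn (fun V : ι → α => (∑ a ∈ T, g (V a)) ^ p) (T : Set ι) := fun V V' h => by
  dsimp only
  rw [sum_congr rfl fun a ha => by rw [h a ha]]

lemma expect_sum_apply_sq_le {g : α → ℝ} (hg : 𝔼 v, g v = 0) (hb : ∀ v, |g v| ≤ 1)
    (T : Finset ι) : 𝔼 V : ι → α, (∑ a ∈ T, g (V a)) ^ 2 ≤ T.card := by
  induction T using Finset.induction_on with
  | empty => simp
  | insert a T ha ih =>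
    have h1 : 𝔼 V : ι → α, g (V a) * (∑ a ∈ T, g (V a)) ^ 1 = 0 :=
      expect_apply_mul_eq_zero hg (dependsOn_sum_apply g T 1) (by simpa using ha)
    have h2 : 𝔼 V : ι → α, g (V a) ^ 2 ≤ 1 := by
      refine expect_le univ_nonempty fun V _ => ?_
      rw [sq_le_one_iff_abs_le_one]
      exact hb _
    have e : ∀ V : ι → α, (∑ a ∈ insert a T, g (V a)) ^ 2 =
        g (V a) ^ 2 + 2 * (g (V a) * (∑ a ∈ T, g (V a)) ^ 1) + (∑ a ∈ T, g (V a)) ^ 2 := fun V => by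
      rw [sum_insert ha]
      ring
    simp only [e, expect_add_distrib, ← mul_expect, h1, card_insert_of_notMem ha]
    push_cast
    linarith

lemma expect_sum_apply_pow_four_le {g : α → ℝ} (hg : 𝔼 v, g v = 0) (hb : ∀ v, |g v| ≤ 1)
    (T : Finset ι) : 𝔼 V : ι → α, (∑ a ∈ T, g (V a)) ^ 4 ≤ 3 * (T.card : ℝ) ^ 2 := by
  induction T using Finset.induction_on with
  | empty => simp
  | insert a T ha ih =>
    have h1 : 𝔼 V : ι → α, g (V a) * (∑ a ∈ T, g (V a)) ^ 3 = 0 :=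
      expect_apply_mul_eq_zero hg (dependsOn_sum_apply g T 3) (by simpa using ha)
    have h3 : 𝔼 V : ι → α, g (V a) ^ 3 * (∑ a ∈ T, g (V a)) ^ 1 = 0 := by
      rw [expect_mul_eq_of_dependsOn (dependsOn_apply (fun v => g v ^ 3) a)
        (dependsOn_sum_apply g T 1) (by simpa using ha)]
      simp only [pow_one, expect_sum_comm, expect_apply_eq, hg, sum_const_zero, mul_zero]
    have hsq : ∀ v, g v ^ 2 ≤ 1 := fun v => by
      rw [sq_le_one_iff_abs_le_one]
      exact hb _
    have h4 : 𝔼 V : ι → α, g (V a) ^ 4 ≤ 1 := by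
      refine expect_le univ_nonempty fun V _ => ?_
      nlinarith [hsq (V a), sq_nonneg (g (V a))]
    have h2 : 𝔼 V : ι → α, g (V a) ^ 2 * (∑ a ∈ T, g (V a)) ^ 2 ≤ T.card := by
      refine le_trans (expect_le_expect fun V _ => ?_) (expect_sum_apply_sq_le hg hb T)
      nlinarith [hsq (V a), sq_nonneg (∑ a ∈ T, g (V a))]
    have e : ∀ V : ι → α, (∑ a ∈ insert a T, g (V a)) ^ 4 =
        g (V a) ^ 4 + 4 * (g (V a) ^ 3 * (∑ a ∈ T, g (V a)) ^ 1) +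
        6 * (g (V a) ^ 2 * (∑ a ∈ T, g (V a)) ^ 2) +
        4 * (g (V a) * (∑ a ∈ T, g (V a)) ^ 3) + (∑ a ∈ T, g (V a)) ^ 4 := fun V => by
      rw [sum_insert ha]
      ring
    simp only [e, expect_add_distrib, ← mul_expect, h1, h3, card_insert_of_notMem ha]
    push_cast
    nlinarith

variable {g g' : α → ℝ}

lemma expect_apply_mul_apply (hg : 𝔼 v, g v = 0) (a b : ι) :
    𝔼 V : ι → α, g (V a) * g' (V b) = if a = b then 𝔼 v, g v * g' v else 0 := by
  split_ifs with h
  · subst h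
    exact expect_apply_eq (fun v => g v * g' v) a
  · exact expect_apply_mul_eq_zero hg (dependsOn_apply g' b) (by simpa using h)

lemma expect_apply_mul_three (hg : 𝔼 v, g v = 0) {a b : ι} (hab : a ≠ b) (c : ι) :
    𝔼 V : ι → α, g (V a) * g (V b) * g' (V c) = 0 := by
  by_cases hac : a = c
  · have e : ∀ V : ι → α, g (V a) * g (V b) * g' (V c) = g (V b) * (g (V a) * g' (V c)) :=
      fun V => by ring
    simp only [e]
    refine expect_apply_mul_eq_zero hg (s := {a, c}) (fun V V' h => ?_) ?_
    · simp [h a (by simp), h c (by simp)]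
    · subst hac
      simpa using hab.symm
  · simp only [mul_assoc]
    refine expect_apply_mul_eq_zero hg (s := {b, c}) (fun V V' h => ?_) ?_
    · simp [h b (by simp), h c (by simp)]
    · simp [hab, hac]

lemma expect_apply_mul_four (hg : 𝔼 v, g v = 0) {a b c d : ι} (hab : a ≠ b) (hcd : c ≠ d) :
    𝔼 V : ι → α, g (V a) * g (V b) * (g' (V c) * g' (V d)) =
      (𝔼 v, g v * g' v) ^ 2 * ((if a = c ∧ b = d then 1 else 0) +
        if a = d ∧ b = c then 1 else 0) := by
  have hpair : 𝔼 V : ι → α, (g (V a) * g' (V a)) * (g (V b) * g' (V b)) =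
      (𝔼 v, g v * g' v) ^ 2 := by
    rw [expect_mul_eq_of_dependsOn (dependsOn_apply (fun v => g v * g' v) a)
      (dependsOn_apply (fun v => g v * g' v) b) (by simpa using hab),
      expect_apply_eq (fun v => g v * g' v), expect_apply_eq (fun v => g v * g' v), sq]
  by_cases h1 : a = c ∧ b = d
  · obtain ⟨rfl, rfl⟩ := h1
    rw [if_pos ⟨rfl, rfl⟩, if_neg (by tauto), ← hpair]
    simp only [add_zero, mul_one]
    exact expect_congr rfl fun V _ => by ring
  by_cases h2 : a = d ∧ b = c
  · obtain ⟨rfl, rfl⟩ := h2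
    rw [if_neg h1, if_pos ⟨rfl, rfl⟩, ← hpair]
    simp only [zero_add, mul_one]
    exact expect_congr rfl fun V _ => by ring
  rw [if_neg h1, if_neg h2, add_zero, mul_zero]
  by_cases ha : a ≠ c ∧ a ≠ d
  · simp only [mul_assoc]
    refine expect_apply_mul_eq_zero hg (s := {b, c, d}) (fun V V' h => ?_) ?_
    · simp [h b (by simp), h c (by simp), h d (by simp)]
    · simp [hab, ha]
  · have e : ∀ V : ι → α, g (V a) * g (V b) * (g' (V c) * g' (V d)) =
      g (V b) * (g (V a) * (g' (V c) * g' (V d))) := fun V => by ring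
    simp only [e]
    refine expect_apply_mul_eq_zero hg (s := {a, c, d}) (fun V V' h => ?_) ?_
    · simp [h a (by simp), h c (by simp), h d (by simp)]
    · simp only [Set.mem_insert_iff, Set.mem_singleton_iff]
      grind

end IndependentLabels

section Coupling

open Finset

variable {n : ℕ}

lemma abs_cind_le {t : ℕ} (ht : t ≤ n) (j : Fin n) : |cind t j| ≤ 1 := by
  have hn : (0 : ℝ) < n := by exact_mod_cast j.pos
  have h0 : (0 : ℝ) ≤ t / n := by positivity
  have h1 : (t : ℝ) / n ≤ 1 := by
    rw [div_le_one hn]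
    exact_mod_cast ht
  rw [cind, abs_le]
  split_ifs <;> constructor <;> linarith

lemma expect_cind {t : ℕ} (hn : 0 < n) (ht : t ≤ n) : 𝔼 j : Fin n, cind t j = 0 := by
  rw [Fintype.expect_eq_sum_div_card, sum_cind hn ht, zero_div]

/-- The limiting covariance kernel of the centred label indicators. -/
def cindCov (n t t' : ℕ) : ℝ := (min t t' : ℕ) / n - (t : ℝ) / n * (t' / n)

lemma expect_cind_mul_cind {t t' : ℕ} (hn : 0 < n) (ht : t ≤ n) (ht' : t' ≤ n) :
    𝔼 j : Fin n, cind t j * cind t' j = cindCov n t t' := by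
  have hn' : (n : ℝ) ≠ 0 := by positivity
  have h : ∀ j : Fin n, cind t j * cind t' j =
      cind (min t t') j + (min t t' : ℕ) / n - (t : ℝ) / n * cind t' j - (t' : ℝ) / n * cind t j -
        (t : ℝ) / n * (t' / n) := by
    intro j
    simp only [cind, lt_min_iff, ite_and]
    split_ifs <;> ring
  have : Nonempty (Fin n) := ⟨⟨0, hn⟩⟩
  simp only [h, expect_sub_distrib, expect_add_distrib, ← mul_expect, expect_cind hn ht,
    expect_cind hn ht', expect_cind hn ((min_le_left _ _).trans ht), Fintype.expect_const, cindCov]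
  ring

lemma expect_coupled_eq {M : Type*} [AddCommMonoid M] [Module ℚ≥0 M]
    (F : (Fin n → Fin n) → M) :
    𝔼 V : Fin n → Fin n, 𝔼 σ : Equiv.Perm (Fin n), F (V ∘ Tuple.sort V ∘ σ) = 𝔼 V, F V := by
  have h1 : ∀ V : Fin n → Fin n, 𝔼 σ : Equiv.Perm (Fin n), F (V ∘ Tuple.sort V ∘ σ) =
      𝔼 σ : Equiv.Perm (Fin n), F (V ∘ σ) := fun V =>
    Fintype.expect_equiv (Equiv.mulLeft (Tuple.sort V)) _ _ fun σ => rfl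
  have h2 : ∀ σ : Equiv.Perm (Fin n), 𝔼 V : Fin n → Fin n, F (V ∘ σ) = 𝔼 V, F V := fun σ =>
    Fintype.expect_equiv (Equiv.arrowCongr σ.symm (Equiv.refl _)) _ _ fun V => rfl
  simp only [h1]
  rw [expect_comm]
  simp only [h2, Fintype.expect_const]

/-- The difference between the label indicators and the sorted values of `V`. -/
def sortGap (t : ℕ) (V : Fin n → Fin n) (j : Fin n) : ℝ :=
  cind t j - cind t (V (Tuple.sort V j))

lemma abs_sortGap_le (t : ℕ) (V : Fin n → Fin n) (j : Fin n) : |sortGap t V j| ≤ 1 := by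
  simp only [sortGap, cind, sub_sub_sub_cancel_right]
  split_ifs <;> norm_num

lemma sum_cind_sort (t : ℕ) (V : Fin n → Fin n) :
    ∑ j, cind t (V (Tuple.sort V j)) = ∑ a, cind t (V a) :=
  Equiv.sum_comp (Tuple.sort V) fun a => cind t (V a)

lemma sum_abs_sortGap {t : ℕ} (hn : 0 < n) (ht : t ≤ n) (V : Fin n → Fin n) :
    ∑ j, |sortGap t V j| = |∑ a, cind t (V a)| := by
  have hsum : ∑ j, sortGap t V j = -∑ a, cind t (V a) := by
    simp only [sortGap, sum_sub_distrib, sum_cind hn ht, sum_cind_sort, zero_sub]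
  rw [← abs_neg, ← hsum]
  have hm : Monotone fun j => V (Tuple.sort V j) := Tuple.monotone_sort V
  by_cases h : ∃ j, 0 < sortGap t V j
  · obtain ⟨j, hj⟩ := h
    have : ∀ j', 0 ≤ sortGap t V j' := by
      intro j'
      by_contra! hj'
      simp only [sortGap, cind, sub_sub_sub_cancel_right] at hj hj'
      have h1 : (j : ℕ) < t ∧ ¬ (V (Tuple.sort V j) : ℕ) < t := by
        split_ifs at hj <;> first | (exfalso; linarith) | tauto
      have h2 : ¬ (j' : ℕ) < t ∧ (V (Tuple.sort V j') : ℕ) < t := by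
        split_ifs at hj' <;> first | (exfalso; linarith) | tauto
      have h3 : V (Tuple.sort V j) ≤ V (Tuple.sort V j') := hm (Fin.le_def.2 (by omega))
      have h4 := Fin.le_def.1 h3
      omega
    rw [abs_of_nonneg (sum_nonneg fun j _ => this j)]
    exact sum_congr rfl fun j _ => abs_of_nonneg (this j)
  · push Not at h
    rw [abs_of_nonpos (sum_nonpos fun j _ => h j), ← sum_neg_distrib]
    exact sum_congr rfl fun j _ => abs_of_nonpos (h j)

lemma quadStat_sub_sorted {W : Fin n → Fin n → ℝ} (hsymm : ∀ a b, W a b = W b a) (t : ℕ)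
    (V : Fin n → Fin n) (σ : Equiv.Perm (Fin n)) :
    quadStat W t σ - quadStat W t (V ∘ Tuple.sort V ∘ σ) =
      (∑ a, ∑ b, W a b * ((cind t (σ a) + cind t (V (Tuple.sort V (σ a)))) *
        sortGap t V (σ b))) / 2 := by
  have e : ∀ a b, W a b * ((cind t (σ a) + cind t (V (Tuple.sort V (σ a)))) *
        sortGap t V (σ b)) = W a b * (cind t (σ a) * cind t (σ b)) -
        W a b * (cind t (V (Tuple.sort V (σ a))) * cind t (V (Tuple.sort V (σ b)))) +
        (W a b * (cind t (V (Tuple.sort V (σ a))) * cind t (σ b)) -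
        W a b * (cind t (σ a) * cind t (V (Tuple.sort V (σ b))))) := fun a b => by
    rw [sortGap]
    ring
  have h : ∑ a, ∑ b, W a b * (cind t (V (Tuple.sort V (σ a))) * cind t (σ b)) =
      ∑ a, ∑ b, W a b * (cind t (σ a) * cind t (V (Tuple.sort V (σ b)))) := by
    rw [sum_comm]
    refine sum_congr rfl fun a _ => sum_congr rfl fun b _ => ?_
    rw [hsymm]
    ring
  simp only [e, sum_add_distrib, sum_sub_distrib, h]
  simp only [quadStat, Function.comp_apply]
  ring

lemma expect_abs_sum_cind_le {t : ℕ} (hn : 0 < n) (ht : t ≤ n) :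
    𝔼 V : Fin n → Fin n, |∑ a, cind t (V a)| ≤ √n := by
  have : Nonempty (Fin n) := ⟨⟨0, hn⟩⟩
  refine (expect_abs_le_sqrt _).trans (Real.sqrt_le_sqrt ?_)
  simpa using expect_sum_apply_sq_le (ι := Fin n) (expect_cind hn ht) (abs_cind_le ht) univ

lemma expect_sum_cind_cubic_le {t : ℕ} (hn : 0 < n) (ht : t ≤ n) :
    𝔼 V : Fin n → Fin n, (|∑ a, cind t (V a)| + 6) * |∑ a, cind t (V a)| ^ 2 ≤ 8 * (n * √n) := by
  have : Nonempty (Fin n) := ⟨⟨0, hn⟩⟩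
  have h2 := expect_sum_apply_sq_le (ι := Fin n) (expect_cind hn ht) (abs_cind_le ht) univ
  have h4 := expect_sum_apply_pow_four_le (ι := Fin n) (expect_cind hn ht) (abs_cind_le ht) univ
  simp only [card_univ, Fintype.card_fin] at h2 h4
  have h3 := abs_expect_mul_le (fun V : Fin n → Fin n => |∑ a, cind t (V a)|)
    fun V => |∑ a, cind t (V a)| ^ 2
  simp only [sq_abs, ← pow_mul] at h3
  have h5 : √((𝔼 V : Fin n → Fin n, (∑ a, cind t (V a)) ^ 2) *
      𝔼 V : Fin n → Fin n, (∑ a, cind t (V a)) ^ (2 * 2)) ≤ 2 * (n * √n) := by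
    rw [Real.sqrt_le_iff]
    refine ⟨by positivity, ?_⟩
    have hs : √(n : ℝ) ^ 2 = n := Real.sq_sqrt (by positivity)
    calc _ ≤ (n : ℝ) * (3 * (n : ℝ) ^ 2) := by
          refine mul_le_mul h2 h4 (expect_nonneg fun V _ => by rw [pow_mul]; positivity)
            (by positivity)
      _ ≤ 4 * ((n : ℝ) ^ 2 * √n ^ 2) := by
          rw [hs]
          nlinarith [pow_nonneg (Nat.cast_nonneg (α := ℝ) n) 3]
      _ = _ := by ring
  have h6 : (n : ℝ) ≤ n * √n := by
    refine le_mul_of_one_le_right (by positivity) ?_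
    rw [Real.one_le_sqrt]
    exact_mod_cast hn
  simp only [add_mul, expect_add_distrib, ← mul_expect, sq_abs]
  have h7 := (le_abs_self _).trans h3
  linarith

lemma expect_quadStat_sub_sorted_sq_le (hn : 6 ≤ n) {t : ℕ} (ht : t ≤ n)
    {W : Fin n → Fin n → ℝ} (hW : ∀ a b, 0 ≤ W a b) (hsymm : ∀ a b, W a b = W b a)
    (hdiag : ∀ a, W a a = 0) :
    𝔼 V : Fin n → Fin n, 𝔼 σ : Equiv.Perm (Fin n),
      (quadStat W t σ - quadStat W t (V ∘ Tuple.sort V ∘ σ)) ^ 2 ≤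
      20 * (∑ a, (∑ b, W a b) ^ 2) / √n := by
  have hn0 : 0 < n := by omega
  have hn' : (6 : ℝ) ≤ n := by exact_mod_cast hn
  set A := ∑ a, (∑ b, W a b) ^ 2 with hA
  have hA0 : 0 ≤ A := sum_nonneg fun _ _ => sq_nonneg _
  have hT : (∑ a, ∑ b, W a b) ^ 2 ≤ n * A := by
    have := sq_sum_le_card_mul_sum_sq (s := (univ : Finset (Fin n))) (f := fun a => ∑ b, W a b)
    simpa using this
  have hone : ∀ V : Fin n → Fin n, 𝔼 σ : Equiv.Perm (Fin n),
      (quadStat W t σ - quadStat W t (V ∘ Tuple.sort V ∘ σ)) ^ 2 ≤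
      4 * A / n * |∑ a, cind t (V a)| + 2 * A / n ^ 2 *
        ((|∑ a, cind t (V a)| + 6) * |∑ a, cind t (V a)| ^ 2) := by
    intro V
    have hΔ := sum_abs_sortGap hn0 ht V
    have hs : ∀ j, |cind t j + cind t (V (Tuple.sort V j))| ≤ 2 := fun j => by
      refine (abs_add_le _ _).trans ?_
      linarith [abs_cind_le ht j, abs_cind_le ht (V (Tuple.sort V j))]
    have h := expect_perm_quadratic_sq_le (by omega) hW hsymm hdiag
      (s := fun j => cind t j + cind t (V (Tuple.sort V j))) (δ := sortGap t V) hs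
      (abs_sortGap_le t V)
      (by simp only [sum_add_distrib, sum_cind hn0 ht, sum_cind_sort, zero_add, hΔ, le_refl])
    rw [hΔ] at h
    set Δ := |∑ a, cind t (V a)|
    have hΔ0 : 0 ≤ Δ := abs_nonneg _
    simp only [quadStat_sub_sorted hsymm, div_pow, ← expect_div]
    have h2 : (∑ a, ∑ b, W a b) ^ 2 * (2 * (Δ + 6) * Δ ^ 2 / (n * (n - 1) * (n - 3))) ≤
        8 * A / n ^ 2 * ((Δ + 6) * Δ ^ 2) := by
      have hden : (n : ℝ) ^ 3 / 4 ≤ n * (n - 1) * (n - 3) := by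
        have : (n : ℝ) ^ 2 / 4 ≤ (n - 1) * (n - 3) := by nlinarith
        nlinarith
      have hpos : (0 : ℝ) < n ^ 3 / 4 := by positivity
      calc _ ≤ (n * A) * (2 * (Δ + 6) * Δ ^ 2 / ((n : ℝ) ^ 3 / 4)) :=
            mul_le_mul hT (div_le_div_of_nonneg_left (by positivity) hpos hden)
              (div_nonneg (by positivity) (hpos.le.trans hden)) (by positivity)
        _ = _ := by
          field_simp
          ring
    rw [div_le_iff₀ (by norm_num)]
    calc _ ≤ _ := h
      _ ≤ 16 * (Δ / n) * A + 8 * A / n ^ 2 * ((Δ + 6) * Δ ^ 2) := by gcongr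
      _ = _ := by ring
  refine (expect_le_expect fun V _ => hone V).trans ?_
  simp only [expect_add_distrib, ← mul_expect]
  have hs : √(n : ℝ) * √n = n := Real.mul_self_sqrt (by positivity)
  have hs0 : 0 < √(n : ℝ) := Real.sqrt_pos.2 (by linarith)
  calc _ ≤ 4 * A / n * √n + 2 * A / n ^ 2 * (8 * (n * √n)) := by
        gcongr
        exacts [expect_abs_sum_cind_le hn0 ht, expect_sum_cind_cubic_le hn0 ht]
    _ = _ := by
      field_simp
      nlinarith

lemma expect_linStat_sub_sorted_sq_le (hn : 2 ≤ n) {t : ℕ} (ht : t ≤ n)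
    {d : Fin n → ℝ} (hd : ∑ a, d a = 0) :
    𝔼 V : Fin n → Fin n, 𝔼 σ : Equiv.Perm (Fin n),
      (linStat d t σ - linStat d t (V ∘ Tuple.sort V ∘ σ)) ^ 2 ≤ 2 * (∑ a, d a ^ 2) / √n := by
  have hn0 : 0 < n := by omega
  have hn' : (2 : ℝ) ≤ n := by exact_mod_cast hn
  set A := ∑ a, d a ^ 2 with hA
  have hA0 : 0 ≤ A := sum_nonneg fun _ _ => sq_nonneg _
  have hone : ∀ V : Fin n → Fin n, 𝔼 σ : Equiv.Perm (Fin n),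
      (linStat d t σ - linStat d t (V ∘ Tuple.sort V ∘ σ)) ^ 2 ≤
      2 * A / n * |∑ a, cind t (V a)| := by
    intro V
    have h := expect_perm_sum_mul_sq_le_of_sum_left hn hd (sortGap t V)
    have e : ∀ σ : Equiv.Perm (Fin n), linStat d t σ - linStat d t (V ∘ Tuple.sort V ∘ σ) =
        ∑ a, d a * sortGap t V (σ a) := fun σ => by
      simp only [linStat, sortGap, mul_sub, sum_sub_distrib, Function.comp_apply]
    simp only [e]
    refine h.trans ?_
    have : ∑ j, sortGap t V j ^ 2 ≤ |∑ a, cind t (V a)| := by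
      rw [← sum_abs_sortGap hn0 ht V]
      refine sum_le_sum fun j _ => ?_
      rw [← sq_abs]
      nlinarith [abs_sortGap_le t V j, abs_nonneg (sortGap t V j)]
    calc _ ≤ 2 * A * (|∑ a, cind t (V a)| / n) := by gcongr
      _ = _ := by ring
  refine (expect_le_expect fun V _ => hone V).trans ?_
  simp only [← mul_expect]
  have hs : √(n : ℝ) * √n = n := Real.mul_self_sqrt (by positivity)
  have hs0 : 0 < √(n : ℝ) := Real.sqrt_pos.2 (by linarith)
  calc _ ≤ 2 * A / n * √n := by
        gcongr
        exact expect_abs_sum_cind_le hn0 ht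
    _ = _ := by
      field_simp
      nlinarith

lemma expect_perm_linStat_sq_le (hn : 2 ≤ n) {t : ℕ} (ht : t ≤ n) {d : Fin n → ℝ}
    (hd : ∀ a, 0 ≤ d a) :
    𝔼 σ : Equiv.Perm (Fin n), linStat d t σ ^ 2 ≤ ∑ a, d a ^ 2 := by
  refine (expect_perm_sum_mul_sq_le_of_sum_right hn hd (sum_cind (by omega) ht)).trans ?_
  refine mul_le_of_le_one_right (sum_nonneg fun _ _ => sq_nonneg _) ?_
  have hn' : (2 : ℝ) ≤ n := by exact_mod_cast hn
  rw [div_le_one (by linarith)]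
  refine (sum_le_sum (g := fun _ => 1) fun j _ => ?_).trans (by simp)
  rw [sq_le_one_iff_abs_le_one]
  exact abs_cind_le ht j

variable {t t' : ℕ} {W : Fin n → Fin n → ℝ} {d : Fin n → ℝ}

lemma expect_linStat (hn : 0 < n) (ht : t ≤ n) : 𝔼 V : Fin n → Fin n, linStat d t V = 0 := by
  have : Nonempty (Fin n) := ⟨⟨0, hn⟩⟩
  simp only [linStat, expect_sum_comm, ← mul_expect, expect_apply_eq, expect_cind hn ht, mul_zero,
    sum_const_zero]

lemma expect_quadStat (hn : 0 < n) (ht : t ≤ n) (hdiag : ∀ a, W a a = 0) :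
    𝔼 V : Fin n → Fin n, quadStat W t V = 0 := by
  have : Nonempty (Fin n) := ⟨⟨0, hn⟩⟩
  simp only [quadStat, ← expect_div, expect_sum_comm, ← mul_expect,
    expect_apply_mul_apply (expect_cind hn ht)]
  simp [hdiag]

lemma expect_linStat_mul_linStat (hn : 0 < n) (ht : t ≤ n) (ht' : t' ≤ n) :
    𝔼 V : Fin n → Fin n, linStat d t V * linStat d t' V = (∑ a, d a ^ 2) * cindCov n t t' := by
  have : Nonempty (Fin n) := ⟨⟨0, hn⟩⟩
  simp only [linStat, sum_mul_sum, expect_sum_comm, mul_mul_mul_comm (d _), ← mul_expect,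
    expect_apply_mul_apply (expect_cind hn ht), expect_cind_mul_cind hn ht ht']
  simp [sum_mul, sq]

lemma expect_quadStat_mul_linStat (hn : 0 < n) (ht : t ≤ n) (hdiag : ∀ a, W a a = 0) :
    𝔼 V : Fin n → Fin n, quadStat W t V * linStat d t' V = 0 := by
  have : Nonempty (Fin n) := ⟨⟨0, hn⟩⟩
  have h : ∀ a b c, 𝔼 V : Fin n → Fin n,
      W a b * (cind t (V a) * cind t (V b)) * (d c * cind t' (V c)) = 0 := by
    intro a b c
    by_cases hab : a = b
    · simp [hab, hdiag]
    simp only [mul_mul_mul_comm (W a b), ← mul_expect,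
      expect_apply_mul_three (expect_cind hn ht) hab, mul_zero]
  simp only [quadStat, linStat, div_mul_eq_mul_div, ← expect_div, sum_mul]
  simp only [mul_sum, expect_sum_comm, h, sum_const_zero, zero_div]

lemma expect_quadStat_mul_quadStat (hn : 0 < n) (ht : t ≤ n) (ht' : t' ≤ n)
    (hsymm : ∀ a b, W a b = W b a) (hdiag : ∀ a, W a a = 0) :
    𝔼 V : Fin n → Fin n, quadStat W t V * quadStat W t' V =
      (∑ a, ∑ b, W a b ^ 2) / 2 * cindCov n t t' ^ 2 := by
  have : Nonempty (Fin n) := ⟨⟨0, hn⟩⟩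
  have h : ∀ a b c e, 𝔼 V : Fin n → Fin n,
      W a b * (cind t (V a) * cind t (V b)) * (W c e * (cind t' (V c) * cind t' (V e))) =
      W a b * cindCov n t t' ^ 2 * (W c e * ((if a = c then if b = e then 1 else 0 else 0) +
        if b = c then if a = e then 1 else 0 else 0)) := by
    intro a b c e
    by_cases hab : a = b
    · simp [hab, hdiag]
    by_cases hce : c = e
    · simp [hce, hdiag]
    simp only [mul_mul_mul_comm (W a b), ← mul_expect,
      expect_apply_mul_four (expect_cind hn ht) hab hce, expect_cind_mul_cind hn ht ht', ite_and]
    have : (if a = e then if b = c then (1 : ℝ) else 0 else 0) =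
      if b = c then if a = e then 1 else 0 else 0 := by split_ifs <;> rfl
    rw [this]
  simp only [quadStat, div_mul_div_comm, ← expect_div, sum_mul]
  simp only [mul_sum, expect_sum_comm, h]
  simp only [mul_add, sum_add_distrib, mul_ite, mul_one, mul_zero, sum_ite_irrel,
    sum_const_zero, sum_ite_eq, mem_univ, if_true]
  have e : ∀ a b, W a b * cindCov n t t' ^ 2 * W a b = W a b ^ 2 * cindCov n t t' ^ 2 :=
    fun a b => by ring
  have e' : ∀ a b, W a b * cindCov n t t' ^ 2 * W b a = W a b ^ 2 * cindCov n t t' ^ 2 :=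
    fun a b => by rw [hsymm b a, e]
  simp only [e, e', ← sum_mul]
  ring

end Coupling

section MeanSquareApproximation

open Finset Filter Topology

/-- The function `f` centred and scaled to mean zero and variance one under the uniform
distribution. -/
def stdz {Ω : Type*} [Fintype Ω] (f : Ω → ℝ) (ω : Ω) : ℝ :=
  (f ω - 𝔼 x, f x) / √(𝔼 x, (f x - 𝔼 y, f y) ^ 2)

lemma stdz_sub_div {Ω : Type*} [Fintype Ω] [Nonempty Ω] (f : Ω → ℝ) (k : ℝ) {s : ℝ} (hs : 0 < s) :
    stdz (fun ω => (f ω - k) / s) = stdz f := by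
  funext ω
  have h1 : 𝔼 x, (f x - k) / s = ((𝔼 x, f x) - k) / s := by
    rw [← expect_div, expect_sub_distrib, Fintype.expect_const]
  have h2 : ∀ x, (f x - k) / s - ((𝔼 x, f x) - k) / s = (f x - 𝔼 x, f x) / s := fun x => by ring
  simp only [stdz, h1, h2, div_pow, ← expect_div]
  rw [Real.sqrt_div' _ (sq_nonneg s), Real.sqrt_sq hs.le, div_div_div_cancel_right₀ hs.ne']

variable {Ω : ℕ → Type*} [∀ n, Fintype (Ω n)]

lemma tendsto_expect_mul_zero {f g : ∀ n, Ω n → ℝ} {b : ℝ}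
    (hf : Tendsto (fun n => 𝔼 ω, f n ω ^ 2) atTop (𝓝 0))
    (hg : Tendsto (fun n => 𝔼 ω, g n ω ^ 2) atTop (𝓝 b)) :
    Tendsto (fun n => 𝔼 ω, f n ω * g n ω) atTop (𝓝 0) := by
  refine squeeze_zero_norm (fun n => abs_expect_mul_le (f n) (g n)) ?_
  simpa using (hf.mul hg).sqrt

lemma tendsto_expect_mul_of_sub {A A' B B' : ∀ n, Ω n → ℝ} {b b' c : ℝ}
    (hA : Tendsto (fun n => 𝔼 ω, (A n ω - B n ω) ^ 2) atTop (𝓝 0))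
    (hA' : Tendsto (fun n => 𝔼 ω, (A' n ω - B' n ω) ^ 2) atTop (𝓝 0))
    (hB : Tendsto (fun n => 𝔼 ω, B n ω ^ 2) atTop (𝓝 b))
    (hB' : Tendsto (fun n => 𝔼 ω, B' n ω ^ 2) atTop (𝓝 b'))
    (hBB' : Tendsto (fun n => 𝔼 ω, B n ω * B' n ω) atTop (𝓝 c)) :
    Tendsto (fun n => 𝔼 ω, A n ω * A' n ω) atTop (𝓝 c) := by
  have h := ((hBB'.add (tendsto_expect_mul_zero hA hB')).add (tendsto_expect_mul_zero hA' hB)).add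
    (tendsto_expect_mul_zero hA hA')
  simp only [add_zero, ← expect_add_distrib] at h
  refine h.congr fun n => expect_congr rfl fun ω _ => ?_
  ring

lemma tendsto_expect_sub_sq_trans {A B E : ∀ n, Ω n → ℝ}
    (hAB : Tendsto (fun n => 𝔼 ω, (A n ω - B n ω) ^ 2) atTop (𝓝 0))
    (hBE : Tendsto (fun n => 𝔼 ω, (B n ω - E n ω) ^ 2) atTop (𝓝 0)) :
    Tendsto (fun n => 𝔼 ω, (A n ω - E n ω) ^ 2) atTop (𝓝 0) := by
  have h : Tendsto (fun n => 𝔼 ω, (2 * (A n ω - B n ω) ^ 2 + 2 * (B n ω - E n ω) ^ 2))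
      atTop (𝓝 0) := by
    simp only [expect_add_distrib, ← mul_expect]
    simpa using (hAB.const_mul 2).add (hBE.const_mul 2)
  refine squeeze_zero (fun n => expect_nonneg fun ω _ => sq_nonneg _)
    (fun n => expect_le_expect fun ω _ => ?_) h
  nlinarith [sq_nonneg ((A n ω - B n ω) - (B n ω - E n ω))]

variable [∀ n, Nonempty (Ω n)] {X Y : ∀ n, Ω n → ℝ}

lemma tendsto_expect_centred_sub_sq (hY : ∀ᶠ n in atTop, 𝔼 ω, Y n ω = 0)
    (hXY : Tendsto (fun n => 𝔼 ω, (X n ω - Y n ω) ^ 2) atTop (𝓝 0)) :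
    Tendsto (fun n => 𝔼 ω, ((X n ω - 𝔼 ω', X n ω') - Y n ω) ^ 2) atTop (𝓝 0) := by
  refine squeeze_zero' (Eventually.of_forall fun n => expect_nonneg fun ω _ => sq_nonneg _)
    ?_ hXY
  filter_upwards [hY] with n hn
  have e : ∀ ω, ((X n ω - 𝔼 ω', X n ω') - Y n ω) ^ 2 = (X n ω - Y n ω) ^ 2 -
      2 * (𝔼 ω', X n ω') * (X n ω - Y n ω) + (𝔼 ω', X n ω') ^ 2 := fun ω => by ring
  simp only [e, expect_add_distrib, expect_sub_distrib, ← mul_expect, hn, Fintype.expect_const]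
  nlinarith [sq_nonneg (𝔼 ω', X n ω')]

lemma tendsto_expect_stdz_sub_sq (hY : ∀ᶠ n in atTop, 𝔼 ω, Y n ω = 0)
    (hYY : Tendsto (fun n => 𝔼 ω, Y n ω ^ 2) atTop (𝓝 1))
    (hXY : Tendsto (fun n => 𝔼 ω, (X n ω - Y n ω) ^ 2) atTop (𝓝 0)) :
    Tendsto (fun n => 𝔼 ω, (stdz (X n) ω - Y n ω) ^ 2) atTop (𝓝 0) := by
  have hA := tendsto_expect_centred_sub_sq hY hXY
  have hv : Tendsto (fun n => 𝔼 ω, (X n ω - 𝔼 ω', X n ω') ^ 2) atTop (𝓝 1) := by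
    simp only [sq] at hYY
    simpa only [sq] using tendsto_expect_mul_of_sub hA hA (by simpa only [sq] using hYY)
      (by simpa only [sq] using hYY) hYY
  refine tendsto_expect_sub_sq_trans (B := fun n ω => X n ω - 𝔼 ω', X n ω') ?_ hA
  have e : ∀ n, 𝔼 ω, (stdz (X n) ω - (X n ω - 𝔼 ω', X n ω')) ^ 2 =
      (1 / √(𝔼 ω, (X n ω - 𝔼 ω', X n ω') ^ 2) - 1) ^ 2 *
        𝔼 ω, (X n ω - 𝔼 ω', X n ω') ^ 2 := by
    intro n
    rw [mul_expect]
    refine expect_congr rfl fun ω _ => ?_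
    rw [stdz]
    ring
  simp only [e]
  have h1 : Tendsto (fun n => 1 / √(𝔼 ω, (X n ω - 𝔼 ω', X n ω') ^ 2)) atTop (𝓝 (1 / √1)) :=
    tendsto_const_nhds.div hv.sqrt (by simp)
  simpa using ((h1.sub_const 1).pow 2).mul hv

variable {ι : Type*} [Fintype ι]

lemma tendsto_expect_exp_sub {Z Y : ι → ∀ n, Ω n → ℝ} (θ : ι → ℝ)
    (h : ∀ i, Tendsto (fun n => 𝔼 ω, (Z i n ω - Y i n ω) ^ 2) atTop (𝓝 0)) :
    Tendsto (fun n => (𝔼 ω, Complex.exp (Complex.I * ((∑ i, θ i * Z i n ω : ℝ) : ℂ))) -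
      𝔼 ω, Complex.exp (Complex.I * ((∑ i, θ i * Y i n ω : ℝ) : ℂ))) atTop (𝓝 0) := by
  have hlim : Tendsto (fun n => ∑ i, |θ i| * √(𝔼 ω, (Z i n ω - Y i n ω) ^ 2)) atTop (𝓝 0) := by
    have := tendsto_finsetSum (univ : Finset ι) fun i _ => (h i).sqrt.const_mul |θ i|
    simpa using this
  refine squeeze_zero_norm (fun n => ?_) hlim
  rw [← expect_sub_distrib]
  refine (RCLike.norm_expect_le (K := ℂ)).trans ?_
  calc _ ≤ 𝔼 ω, ∑ i, |θ i| * |Z i n ω - Y i n ω| := expect_le_expect fun ω _ => by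
        refine (norm_exp_I_mul_sub_exp_le _ _).trans ?_
        rw [← sum_sub_distrib]
        refine (abs_sum_le_sum_abs _ _).trans (le_of_eq (sum_congr rfl fun i _ => ?_))
        rw [← mul_sub, abs_mul]
    _ = ∑ i, |θ i| * 𝔼 ω, |Z i n ω - Y i n ω| := by simp only [expect_sum_comm, mul_expect]
    _ ≤ _ := by
      gcongr with i
      exact expect_abs_le_sqrt _

end MeanSquareApproximation

section IndependentLimit

open Finset

variable {n : ℕ} {I : Type*} [Fintype I] {W : Fin n → Fin n → ℝ} {d : Fin n → ℝ} {t : I → ℕ}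
  (α β : I → ℝ)

/-- The summand attached to the ordered pair `p` in a linear combination of quadratic and linear
statistics. -/
def pairSummand (W : Fin n → Fin n → ℝ) (d : Fin n → ℝ) (t : I → ℕ) (p : Fin n × Fin n)
    (V : Fin n → Fin n) : ℝ :=
  W p.1 p.2 / 2 * ∑ i, α i * (cind (t i) (V p.1) * cind (t i) (V p.2)) +
    if p.1 = p.2 then d p.1 * ∑ i, β i * cind (t i) (V p.1) else 0

lemma sum_pairSummand (V : Fin n → Fin n) :
    ∑ p, pairSummand α β W d t p V =
      ∑ i, α i * quadStat W (t i) V + ∑ i, β i * linStat d (t i) V := by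
  simp only [pairSummand, sum_add_distrib, Fintype.sum_prod_type, sum_ite_eq, mem_univ, if_true,
    quadStat, linStat, mul_sum, mul_div_assoc, sum_div]
  congr 1
  · rw [sum_comm_cycle]
    refine sum_congr rfl fun i _ => sum_congr rfl fun a _ => sum_congr rfl fun b _ => ?_
    ring
  · rw [sum_comm]
    refine sum_congr rfl fun i _ => sum_congr rfl fun a _ => ?_
    ring

lemma dependsOn_pairSummand (p : Fin n × Fin n) :
    DependsOn (pairSummand α β W d t p) (({p.1, p.2} : Finset (Fin n)) : Set (Fin n)) := by
  intro V V' h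
  simp only [pairSummand, h p.1 (by simp), h p.2 (by simp)]

lemma expect_pairSummand (ht : ∀ i, t i ≤ n) (hdiag : ∀ a, W a a = 0) (p : Fin n × Fin n) :
    𝔼 V, pairSummand α β W d t p V = 0 := by
  have hn : 0 < n := p.1.pos
  have : Nonempty (Fin n) := ⟨p.1⟩
  have h0 : ∀ i, 𝔼 j : Fin n, cind (t i) j = 0 := fun i => expect_cind hn (ht i)
  by_cases h : p.1 = p.2
  · simp only [pairSummand, h, hdiag, if_true, zero_div, zero_mul, zero_add, ← mul_expect,
      expect_sum_comm, expect_apply_eq, h0, mul_zero, sum_const_zero]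
  · simp only [pairSummand, if_neg h, add_zero, ← mul_expect, expect_sum_comm,
      expect_apply_mul_apply (h0 _), mul_zero, sum_const_zero]

lemma abs_pairSummand_le (ht : ∀ i, t i ≤ n) (hW : ∀ a b, 0 ≤ W a b) {δ K : ℝ}
    (hd : ∀ a, |d a| ≤ δ) (hα : ∑ i, |α i| ≤ K) (hβ : δ * ∑ i, |β i| ≤ K) (p : Fin n × Fin n)
    (V : Fin n → Fin n) :
    |pairSummand α β W d t p V| ≤ K * (W p.1 p.2 + if p.1 = p.2 then 1 else 0) := by
  have hK : 0 ≤ K := (sum_nonneg fun i _ => abs_nonneg (α i)).trans hα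
  have h1 : |∑ i, α i * (cind (t i) (V p.1) * cind (t i) (V p.2))| ≤ K := by
    refine (abs_sum_le_sum_abs _ _).trans ((sum_le_sum fun i _ => ?_).trans hα)
    rw [abs_mul, abs_mul]
    refine mul_le_of_le_one_right (abs_nonneg _) ?_
    exact mul_le_one₀ (abs_cind_le (ht i) _) (abs_nonneg _) (abs_cind_le (ht i) _)
  have h2 : |∑ i, β i * cind (t i) (V p.1)| ≤ ∑ i, |β i| := by
    refine (abs_sum_le_sum_abs _ _).trans (sum_le_sum fun i _ => ?_)
    rw [abs_mul]
    exact mul_le_of_le_one_right (abs_nonneg _) (abs_cind_le (ht i) _)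
  refine (abs_add_le _ _).trans ?_
  rw [mul_add]
  refine add_le_add ?_ ?_
  · rw [abs_mul, abs_of_nonneg (by linarith [hW p.1 p.2]), mul_comm K]
    have := hW p.1 p.2
    calc _ ≤ W p.1 p.2 / 2 * K := by gcongr
      _ ≤ _ := by nlinarith [mul_nonneg this hK]
  · split_ifs
    · rw [abs_mul, mul_one]
      exact (mul_le_mul (hd _) h2 (abs_nonneg _) ((abs_nonneg _).trans (hd p.1))).trans hβ
    · simp

lemma sum_nbhd_pair_le {w : Fin n → Fin n → ℝ} (hw : ∀ a b, 0 ≤ w a b)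
    (hsymm : ∀ a b, w a b = w b a) (p : Fin n × Fin n) :
    ∑ q ∈ nbhd (fun p : Fin n × Fin n => ({p.1, p.2} : Finset (Fin n))) p, w q.1 q.2 ≤
      2 * ∑ b, w p.1 b + 2 * ∑ b, w p.2 b := by
  have h : ∑ q ∈ nbhd (fun p : Fin n × Fin n => ({p.1, p.2} : Finset (Fin n))) p, w q.1 q.2 ≤
      ∑ q : Fin n × Fin n, w q.1 q.2 * ((if q.1 = p.1 then 1 else 0) +
        (if q.1 = p.2 then 1 else 0) + (if q.2 = p.1 then 1 else 0) +
        (if q.2 = p.2 then 1 else 0)) := by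
    refine (sum_le_sum fun q hq => ?_).trans (sum_le_univ_sum_of_nonneg fun q =>
      mul_nonneg (hw _ _) (by positivity))
    refine le_mul_of_one_le_right (hw _ _) ?_
    rw [mem_nbhd, not_disjoint_iff] at hq
    obtain ⟨x, hx, hx'⟩ := hq
    simp only [mem_insert, mem_singleton] at hx hx'
    split_ifs <;> first | (exfalso; grind) | norm_num
  refine h.trans (le_of_eq ?_)
  have col : ∀ b, ∑ a, w a b = ∑ a, w b a := fun b => sum_congr rfl fun a _ => hsymm a b
  simp only [Fintype.sum_prod_type, mul_add, sum_add_distrib, mul_ite, mul_one, mul_zero,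
    sum_ite_irrel, sum_const_zero, sum_ite_eq', mem_univ, if_true, col]
  ring

theorem norm_charFun_stat_sub_gaussian_le (ht : ∀ i, t i ≤ n) (hW : ∀ a b, 0 ≤ W a b)
    (hsymm : ∀ a b, W a b = W b a) (hdiag : ∀ a, W a a = 0) {δ K : ℝ}
    (hd : ∀ a, |d a| ≤ δ) (hα : ∑ i, |α i| ≤ K) (hβ : δ * ∑ i, |β i| ≤ K) :
    ‖(𝔼 V : Fin n → Fin n, Complex.exp (Complex.I *
        ((∑ i, α i * quadStat W (t i) V + ∑ i, β i * linStat d (t i) V : ℝ) : ℂ))) -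
      Complex.exp (((-((𝔼 V : Fin n → Fin n,
        (∑ i, α i * quadStat W (t i) V + ∑ i, β i * linStat d (t i) V) ^ 2) / 2) : ℝ) : ℂ))‖ ≤
      64 * K ^ 3 * ∑ a, (∑ b, W a b + 1) ^ 3 := by
  rcases Nat.eq_zero_or_pos n with rfl | hn
  · simp [quadStat, linStat]
  have : Nonempty (Fin n) := ⟨⟨0, hn⟩⟩
  have hK : 0 ≤ K := (sum_nonneg fun i _ => abs_nonneg (α i)).trans hα
  have h := norm_charFun_sub_gaussian_le (dependsOn_pairSummand (W := W) (d := d) (t := t) α β)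
    (expect_pairSummand α β ht hdiag) (abs_pairSummand_le α β ht hW hd hα hβ)
  simp only [sum_pairSummand] at h
  refine h.trans ?_
  set w : Fin n → Fin n → ℝ := fun a b => W a b + if a = b then 1 else 0 with hw
  have hw0 : ∀ a b, 0 ≤ w a b := fun a b => add_nonneg (hW a b) (by positivity)
  have hws : ∀ a b, w a b = w b a := fun a b => by simp only [hw, hsymm a b, eq_comm]
  have hE : ∀ a, ∑ b, w a b = ∑ b, W a b + 1 := fun a => by simp [hw, sum_add_distrib]
  set E : Fin n → ℝ := fun a => ∑ b, w a b with hEdef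
  have hE0 : ∀ a, 0 ≤ E a := fun a => sum_nonneg fun b _ => hw0 a b
  have hterm : ∀ p : Fin n × Fin n, K * w p.1 p.2 *
      (∑ q ∈ nbhd (fun p : Fin n × Fin n => ({p.1, p.2} : Finset (Fin n))) p,
        K * w q.1 q.2) ^ 2 ≤ 8 * K ^ 3 * (w p.1 p.2 * E p.1 ^ 2 + w p.1 p.2 * E p.2 ^ 2) := by
    intro p
    have h1 := sum_nbhd_pair_le hw0 hws p
    have h0 : 0 ≤ ∑ q ∈ nbhd (fun p : Fin n × Fin n => ({p.1, p.2} : Finset (Fin n))) p,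
      w q.1 q.2 := sum_nonneg fun q _ => hw0 _ _
    rw [← mul_sum]
    have h2 := pow_le_pow_left₀ h0 h1 2
    have h3 : (2 * ∑ b, w p.1 b + 2 * ∑ b, w p.2 b) ^ 2 ≤ 8 * (E p.1 ^ 2 + E p.2 ^ 2) := by
      nlinarith [sq_nonneg (E p.1 - E p.2)]
    calc _ = K ^ 3 * w p.1 p.2 *
          (∑ q ∈ nbhd (fun p : Fin n × Fin n => ({p.1, p.2} : Finset (Fin n))) p,
            w q.1 q.2) ^ 2 := by ring
      _ ≤ K ^ 3 * w p.1 p.2 * (8 * (E p.1 ^ 2 + E p.2 ^ 2)) :=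
        mul_le_mul_of_nonneg_left (h2.trans h3) (mul_nonneg (by positivity) (hw0 _ _))
      _ = _ := by ring
  have hsum : ∑ p : Fin n × Fin n, (w p.1 p.2 * E p.1 ^ 2 + w p.1 p.2 * E p.2 ^ 2) =
      2 * ∑ a, E a ^ 3 := by
    have e1 : ∑ a, ∑ b, w a b * E a ^ 2 = ∑ a, E a ^ 3 := by
      refine sum_congr rfl fun a _ => ?_
      rw [← sum_mul]
      ring
    have e2 : ∑ a, ∑ b, w a b * E b ^ 2 = ∑ a, ∑ b, w a b * E a ^ 2 := by
      rw [sum_comm]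
      simp only [hws]
    simp only [Fintype.sum_prod_type, sum_add_distrib]
    rw [e2, e1]
    ring
  have hfin := sum_le_sum fun p (_ : p ∈ univ) => hterm p
  rw [← mul_sum, hsum] at hfin
  simp only [hEdef, hE] at hfin
  linarith

end IndependentLimit

section Conditions

open Finset Filter Topology

variable {ℓ : ℕ} {Gr : ∀ n : ℕ, Finset (Sym2 (Node n ℓ))}

lemma exists_le_sum_offWeight_sq (h1 : Cond1 ℓ Gr) :
    ∃ c : ℝ, 0 < c ∧ ∀ᶠ n : ℕ in atTop, c * n ≤ (∑ a, ∑ b, offWeight (Gr n) a b ^ 2) / 2 := by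
  obtain ⟨⟨c, _, hc, h⟩, -⟩ := h1
  exact ⟨c, hc, h.mono fun n hn => hn.1.trans (card_Gout_le _)⟩

lemma exists_le_sum_diagWeight_sq (h2 : Cond2 ℓ Gr) :
    ∃ c : ℝ, 0 < c ∧ ∀ᶠ n : ℕ in atTop, c * n ≤ ∑ a, diagWeight (Gr n) a ^ 2 := by
  obtain ⟨-, c, _, hc, h⟩ := h2
  refine ⟨c, hc, ?_⟩
  filter_upwards [h, eventually_gt_atTop 0] with n hn h0
  rw [sum_diagWeight_sq _ h0]
  exact hn.1

lemma exists_sum_Ddeg_sq_le (h1 : Cond1 ℓ Gr) (h2 : Cond2 ℓ Gr) :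
    ∃ C : ℝ, 0 ≤ C ∧ ∀ᶠ n : ℕ in atTop, ∑ a, (Ddeg (Gr n) a : ℝ) ^ 2 ≤ C * n := by
  obtain ⟨⟨_, C, _, h⟩, -⟩ := h1
  obtain ⟨⟨_, C', _, h'⟩, -⟩ := h2
  refine ⟨|C'| + 4 * C ^ 2, by positivity, ?_⟩
  filter_upwards [h, h', eventually_gt_atTop 0] with n hn hn' h0
  have h0' : (0 : ℝ) < n := by exact_mod_cast h0
  have h3 : 4 * ((Gout (Gr n)).card : ℝ) ^ 2 / n ≤ 4 * C ^ 2 * n := by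
    rw [div_le_iff₀ h0']
    have := pow_le_pow_left₀ (Nat.cast_nonneg _) hn.2 2
    nlinarith
  have h4 : C' * n ≤ |C'| * n := by
    gcongr
    exact le_abs_self _
  linarith [hn'.2]

lemma tendsto_sum_Ddeg_cube_div (h3 : Cond3 ℓ Gr) :
    Tendsto (fun n : ℕ => (∑ a, (Ddeg (Gr n) a : ℝ) ^ 3) / (√n) ^ 3) atTop (𝓝 0) := by
  have e : ∀ n : ℕ, (n : ℝ) ^ (1.5 : ℝ) = √n ^ 3 := by
    intro n
    rw [Real.sqrt_eq_rpow, ← Real.rpow_mul_natCast (by positivity)]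
    norm_num
  have h := (h3.tendsto_div_nhds_zero).const_mul 2
  simp only [e, mul_zero] at h
  refine squeeze_zero (fun n => by positivity) (fun n => ?_) h
  rw [← mul_div_assoc]
  gcongr
  exact sum_Ddeg_cube_le _

lemma tendsto_sum_succ_cube_div (h3 : Cond3 ℓ Gr) :
    Tendsto (fun n : ℕ => (∑ a, (∑ b, offWeight (Gr n) a b + 1) ^ 3) / (√n) ^ 3)
      atTop (𝓝 0) := by
  have h1 : Tendsto (fun n : ℕ => (√(n : ℝ))⁻¹) atTop (𝓝 0) :=
    (Real.tendsto_sqrt_atTop.comp tendsto_natCast_atTop_atTop).inv_tendsto_atTop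
  have h := ((tendsto_sum_Ddeg_cube_div h3).const_mul 4).add (h1.const_mul 4)
  simp only [mul_zero, add_zero] at h
  refine squeeze_zero' (Eventually.of_forall fun n => ?_) ?_ h
  · refine div_nonneg (sum_nonneg fun a _ => ?_) (by positivity)
    rw [sum_offWeight]
    positivity
  · filter_upwards [eventually_gt_atTop 0] with n hn
    have hn' : (0 : ℝ) < n := by exact_mod_cast hn
    have hs : √(n : ℝ) ^ 2 = n := Real.sq_sqrt hn'.le
    have hs0 : 0 < √(n : ℝ) := Real.sqrt_pos.2 hn'
    have hb : ∑ a, (∑ b, offWeight (Gr n) a b + 1) ^ 3 ≤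
        4 * (∑ a, (Ddeg (Gr n) a : ℝ) ^ 3) + 4 * n := by
      have : ∀ a, (∑ b, offWeight (Gr n) a b + 1) ^ 3 ≤ 4 * (Ddeg (Gr n) a : ℝ) ^ 3 + 4 := by
        intro a
        rw [sum_offWeight]
        have h0 : (0 : ℝ) ≤ Ddeg (Gr n) a := by positivity
        nlinarith [mul_nonneg (by linarith : (0 : ℝ) ≤ (Ddeg (Gr n) a : ℝ) + 1)
          (sq_nonneg ((Ddeg (Gr n) a : ℝ) - 1))]
      refine (sum_le_sum fun a _ => this a).trans (le_of_eq ?_)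
      simp [sum_add_distrib, mul_sum, mul_comm]
    calc _ ≤ (4 * (∑ a, (Ddeg (Gr n) a : ℝ) ^ 3) + 4 * n) / √n ^ 3 := by gcongr
      _ = _ := by
        rw [add_div, mul_div_assoc]
        congr 1
        rw [← hs]
        field_simp
        rw [hs, hs]

end Conditions

section Coupling

open Finset Filter Topology

/-- The covariance function of the Brownian bridge. -/
def bridgeCov (a b : ℝ) : ℝ := min a b - a * b

lemma bridgeCov_self_pos {a : ℝ} (ha : 0 < a ∧ a < 1) : 0 < bridgeCov a a := by
  rw [bridgeCov, min_self]
  nlinarith [ha.1, ha.2]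

lemma floor_mul_le {a : ℝ} (ha : 0 < a ∧ a < 1) (n : ℕ) : ⌊(n : ℝ) * a⌋₊ ≤ n := by
  refine Nat.floor_le_of_le ?_
  nlinarith [ha.1, ha.2, (Nat.cast_nonneg n : (0 : ℝ) ≤ n)]

lemma tendsto_floor_mul_div {a : ℝ} (ha : 0 ≤ a) :
    Tendsto (fun n : ℕ => (⌊(n : ℝ) * a⌋₊ : ℝ) / n) atTop (𝓝 a) := by
  simpa only [mul_comm, Function.comp_def] using
    (tendsto_nat_floor_mul_div_atTop ha).comp (tendsto_natCast_atTop_atTop (R := ℝ))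

lemma tendsto_cindCov {a b : ℝ} (ha : 0 ≤ a) (hb : 0 ≤ b) :
    Tendsto (fun n : ℕ => cindCov n ⌊(n : ℝ) * a⌋₊ ⌊(n : ℝ) * b⌋₊) atTop
      (𝓝 (bridgeCov a b)) := by
  refine (((tendsto_floor_mul_div ha).min (tendsto_floor_mul_div hb)).sub
    ((tendsto_floor_mul_div ha).mul (tendsto_floor_mul_div hb))).congr fun n => ?_
  rw [cindCov, Nat.cast_min, min_div_div_right (Nat.cast_nonneg n)]

variable {ℓ : ℕ}

/-- Half the sum of the squared off-diagonal weights. -/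
def outScale {n : ℕ} (Gr : Finset (Sym2 (Node n ℓ))) : ℝ := (∑ a, ∑ b, offWeight Gr a b ^ 2) / 2

/-- The sum of the squared diagonal weights. -/
def inScale {n : ℕ} (Gr : Finset (Sym2 (Node n ℓ))) : ℝ := ∑ a, diagWeight Gr a ^ 2

/-- The normalizing constants of the quadratic (left) and linear (right) statistics. -/
def normalizer {n k : ℕ} (Gr : Finset (Sym2 (Node n ℓ))) (u : Fin k → ℝ) :
    Fin k ⊕ Fin k → ℝ
  | .inl i => cindCov n ⌊(n : ℝ) * u i⌋₊ ⌊(n : ℝ) * u i⌋₊ * √(outScale Gr)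
  | .inr i => √(cindCov n ⌊(n : ℝ) * u i⌋₊ ⌊(n : ℝ) * u i⌋₊) * √(inScale Gr)

/-- The normalized quadratic (left) and linear (right) statistics. -/
def normStat {n k : ℕ} (Gr : Finset (Sym2 (Node n ℓ))) (u : Fin k → ℝ)
    (s : Fin k ⊕ Fin k) (f : Fin n → Fin n) : ℝ :=
  s.elim (fun i => quadStat (offWeight Gr) ⌊(n : ℝ) * u i⌋₊ f)
    (fun i => linStat (diagWeight Gr) ⌊(n : ℝ) * u i⌋₊ f) / normalizer Gr u s

/-- The limiting covariance matrix. -/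
def limitCov {k : ℕ} (u : Fin k → ℝ) : Matrix (Fin k ⊕ Fin k) (Fin k ⊕ Fin k) ℝ
  | .inl i, .inl j => bridgeCov (u i) (u j) ^ 2 / (bridgeCov (u i) (u i) * bridgeCov (u j) (u j))
  | .inr i, .inr j =>
    bridgeCov (u i) (u j) / (√(bridgeCov (u i) (u i)) * √(bridgeCov (u j) (u j)))
  | .inl _, .inr _ => 0
  | .inr _, .inl _ => 0

/-- The raw statistics. -/
def rawStat {n k : ℕ} (Gr : Finset (Sym2 (Node n ℓ))) (u : Fin k → ℝ) (s : Fin k ⊕ Fin k)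
    (σ : Equiv.Perm (Fin n)) : ℝ :=
  s.elim (fun i => Routw Gr ⌊(n : ℝ) * u i⌋₊ σ) (fun i => (Rin1 Gr ⌊(n : ℝ) * u i⌋₊ σ : ℝ))

variable {Gr : ∀ n : ℕ, Finset (Sym2 (Node n ℓ))} {k : ℕ} {u : Fin k → ℝ}

lemma limitCov_self (hu : ∀ i, 0 < u i ∧ u i < 1) (s : Fin k ⊕ Fin k) : limitCov u s s = 1 := by
  rcases s with i | i <;> have h := bridgeCov_self_pos (hu i)
  · simp only [limitCov, sq]
    exact div_self (mul_pos h h).ne'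
  · simp only [limitCov, Real.mul_self_sqrt h.le]
    exact div_self h.ne'

lemma eventually_outScale_pos (h1 : Cond1 ℓ Gr) : ∀ᶠ n in atTop, 0 < outScale (Gr n) := by
  obtain ⟨c, hc, h⟩ := exists_le_sum_offWeight_sq h1
  filter_upwards [h, eventually_gt_atTop 0] with n hn h0
  have h0' : (0 : ℝ) < n := by exact_mod_cast h0
  exact (by positivity : 0 < c * n).trans_le hn

lemma eventually_inScale_pos (h2 : Cond2 ℓ Gr) : ∀ᶠ n in atTop, 0 < inScale (Gr n) := by
  obtain ⟨c, hc, h⟩ := exists_le_sum_diagWeight_sq h2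
  filter_upwards [h, eventually_gt_atTop 0] with n hn h0
  have h0' : (0 : ℝ) < n := by exact_mod_cast h0
  exact (by positivity : 0 < c * n).trans_le hn

lemma eventually_cindCov_pos (hu : ∀ i, 0 < u i ∧ u i < 1) (i : Fin k) :
    ∀ᶠ n : ℕ in atTop, 0 < cindCov n ⌊(n : ℝ) * u i⌋₊ ⌊(n : ℝ) * u i⌋₊ :=
  (tendsto_cindCov (hu i).1.le (hu i).1.le).eventually_const_lt (bridgeCov_self_pos (hu i))

lemma eventually_normalizer_pos (h1 : Cond1 ℓ Gr) (h2 : Cond2 ℓ Gr)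
    (hu : ∀ i, 0 < u i ∧ u i < 1) (s : Fin k ⊕ Fin k) :
    ∀ᶠ n in atTop, 0 < normalizer (Gr n) u s := by
  rcases s with i | i
  · filter_upwards [eventually_outScale_pos h1, eventually_cindCov_pos hu i] with n h h'
    exact mul_pos h' (Real.sqrt_pos.2 h)
  · filter_upwards [eventually_inScale_pos h2, eventually_cindCov_pos hu i] with n h h'
    exact mul_pos (Real.sqrt_pos.2 h') (Real.sqrt_pos.2 h)

lemma expect_normStat (hu : ∀ i, 0 < u i ∧ u i < 1) (s : Fin k ⊕ Fin k) {n : ℕ} (hn : 0 < n) :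
    𝔼 V, normStat (Gr n) u s V = 0 := by
  rcases s with i | i
  · simp only [normStat, Sum.elim_inl, ← expect_div,
      expect_quadStat hn (floor_mul_le (hu i) n) (offWeight_self (Gr n)), zero_div]
  · simp only [normStat, Sum.elim_inr, ← expect_div,
      expect_linStat hn (floor_mul_le (hu i) n), zero_div]

lemma tendsto_expect_normStat_mul_normStat (h1 : Cond1 ℓ Gr) (h2 : Cond2 ℓ Gr)
    (hu : ∀ i, 0 < u i ∧ u i < 1) (s s' : Fin k ⊕ Fin k) :
    Tendsto (fun n => 𝔼 V, normStat (Gr n) u s V * normStat (Gr n) u s' V) atTop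
      (𝓝 (limitCov u s s')) := by
  have hlim : ∀ i j, Tendsto (fun n : ℕ => cindCov n ⌊(n : ℝ) * u i⌋₊ ⌊(n : ℝ) * u j⌋₊) atTop
      (𝓝 (bridgeCov (u i) (u j))) := fun i j => tendsto_cindCov (hu i).1.le (hu j).1.le
  have hpos := fun i => bridgeCov_self_pos (hu i)
  rcases s with i | i <;> rcases s' with j | j <;>
    simp only [normStat, Sum.elim_inl, Sum.elim_inr, div_mul_div_comm, ← expect_div, limitCov]
  · refine (((hlim i j).pow 2).div ((hlim i i).mul (hlim j j))
      (mul_pos (hpos i) (hpos j)).ne').congr' ?_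
    filter_upwards [eventually_outScale_pos h1, eventually_gt_atTop 0] with n hS hn
    rw [expect_quadStat_mul_quadStat hn (floor_mul_le (hu i) n) (floor_mul_le (hu j) n)
      (offWeight_comm (Gr n)) (offWeight_self (Gr n)), ← outScale]
    simp only [normalizer]
    rw [mul_mul_mul_comm, Real.mul_self_sqrt hS.le, mul_comm (outScale (Gr n)),
      mul_div_mul_right _ _ hS.ne']
    rfl
  · refine tendsto_const_nhds.congr' ?_
    filter_upwards [eventually_gt_atTop 0] with n hn
    rw [expect_quadStat_mul_linStat hn (floor_mul_le (hu i) n) (offWeight_self (Gr n)), zero_div]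
  · refine tendsto_const_nhds.congr' ?_
    filter_upwards [eventually_gt_atTop 0] with n hn
    simp only [mul_comm (linStat _ _ _)]
    rw [expect_quadStat_mul_linStat hn (floor_mul_le (hu j) n) (offWeight_self (Gr n)), zero_div]
  · refine ((hlim i j).div ((hlim i i).sqrt.mul (hlim j j).sqrt)
      (mul_pos (Real.sqrt_pos.2 (hpos i)) (Real.sqrt_pos.2 (hpos j))).ne').congr' ?_
    filter_upwards [eventually_inScale_pos h2, eventually_gt_atTop 0] with n hS hn
    rw [expect_linStat_mul_linStat hn (floor_mul_le (hu i) n) (floor_mul_le (hu j) n), ← inScale]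
    simp only [normalizer]
    rw [mul_mul_mul_comm, Real.mul_self_sqrt hS.le, mul_comm (inScale (Gr n)),
      mul_div_mul_right _ _ hS.ne']
    rfl

/-- The relabelling of `V` by the permutation `σ` of its order statistics. -/
def coupled {n : ℕ} (p : (Fin n → Fin n) × Equiv.Perm (Fin n)) : Fin n → Fin n :=
  p.1 ∘ Tuple.sort p.1 ∘ p.2

lemma expect_coupled {n : ℕ} {M : Type*} [AddCommMonoid M] [Module ℚ≥0 M]
    (F : (Fin n → Fin n) → M) : 𝔼 p, F (coupled p) = 𝔼 V, F V := by
  rw [← univ_product_univ, expect_product]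
  exact expect_coupled_eq F

lemma expect_snd {n : ℕ} {M : Type*} [AddCommMonoid M] [Module ℚ≥0 M]
    (F : Equiv.Perm (Fin n) → M) :
    𝔼 p : (Fin n → Fin n) × Equiv.Perm (Fin n), F p.2 = 𝔼 σ, F σ := by
  have : Nonempty (Fin n → Fin n) := ⟨id⟩
  rw [← univ_product_univ, expect_product]
  exact Fintype.expect_const (ι := Fin n → Fin n) (𝔼 σ, F σ)

lemma abs_weight_gap_le {n t : ℕ} (hn : 4 ≤ n) (ht : t ≤ n) :
    |((t : ℝ) - 1) / (n - 2) - t / n| ≤ 2 / n := by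
  have hn' : (4 : ℝ) ≤ n := by exact_mod_cast hn
  have ht' : (t : ℝ) ≤ n := by exact_mod_cast ht
  have h0 : (0 : ℝ) ≤ t := Nat.cast_nonneg t
  have h2 : (0 : ℝ) < n - 2 := by linarith
  have h3 : (0 : ℝ) < n := by linarith
  rw [div_sub_div _ _ h2.ne' h3.ne', abs_div, abs_of_pos (mul_pos h2 h3), div_le_div_iff₀
    (mul_pos h2 h3) h3]
  have : |((t : ℝ) - 1) * n - (n - 2) * t| ≤ n := abs_le.2 ⟨by linarith, by linarith⟩
  nlinarith

lemma exists_tendsto_rawStat_sub_normStat (h1 : Cond1 ℓ Gr) (h2 : Cond2 ℓ Gr)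
    (hu : ∀ i, 0 < u i ∧ u i < 1) (s : Fin k ⊕ Fin k) :
    ∃ K : ℕ → ℝ, Tendsto (fun n => 𝔼 p : (Fin n → Fin n) × Equiv.Perm (Fin n),
      ((rawStat (Gr n) u s p.2 - K n) / normalizer (Gr n) u s -
        normStat (Gr n) u s (coupled p)) ^ 2) atTop (𝓝 0) := by
  have hsqrt : Tendsto (fun n : ℕ => (√(n : ℝ))⁻¹) atTop (𝓝 0) :=
    (Real.tendsto_sqrt_atTop.comp tendsto_natCast_atTop_atTop).inv_tendsto_atTop
  have hnn : ∀ n (F : (Fin n → Fin n) × Equiv.Perm (Fin n) → ℝ), 0 ≤ 𝔼 p, F p ^ 2 :=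
    fun n F => expect_nonneg fun p _ => sq_nonneg _
  rcases s with i | i
  · obtain ⟨c, hc, hcS⟩ := exists_le_sum_offWeight_sq h1
    obtain ⟨C, hC, hCD⟩ := exists_sum_Ddeg_sq_le h1 h2
    set T : ℕ → ℕ := fun n => ⌊(n : ℝ) * u i⌋₊ with hT
    set r : ℕ → ℝ := fun n => ((T n : ℝ) - 1) / (n - 2) - T n / n with hr
    refine ⟨fun n => (((T n : ℝ) / n) ^ 2 + ((T n : ℝ) - 1) / (n - 2) -
      2 * (((T n : ℝ) - 1) / (n - 2)) * (T n / n)) * (Gout (Gr n)).card, ?_⟩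
    have hlim : Tendsto (fun n : ℕ => (40 * C * (√(n : ℝ))⁻¹ + 8 * C * ((√(n : ℝ))⁻¹) ^ 4) /
        (cindCov n (T n) (T n) ^ 2 * c)) atTop (𝓝 0) := by
      have := ((hsqrt.const_mul (40 * C)).add ((hsqrt.pow 4).const_mul (8 * C))).div
        (((tendsto_cindCov (hu i).1.le (hu i).1.le).pow 2).mul_const c)
        (mul_pos (pow_pos (bridgeCov_self_pos (hu i)) 2) hc).ne'
      simpa [Pi.div_def, hT] using this
    refine squeeze_zero' (Eventually.of_forall fun n => hnn n _) ?_ hlim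
    filter_upwards [hcS, hCD, eventually_ge_atTop 6, eventually_cindCov_pos hu i,
      eventually_normalizer_pos h1 h2 hu (.inl i)] with n hcn hCn hn hpos hN
    have ht : T n ≤ n := floor_mul_le (hu i) n
    have hn' : (0 : ℝ) < n := by exact_mod_cast (by omega : 0 < n)
    have hs0 : 0 < √(n : ℝ) := Real.sqrt_pos.2 hn'
    have hs : √(n : ℝ) ^ 2 = n := Real.sq_sqrt hn'.le
    have hq := expect_quadStat_sub_sorted_sq_le hn ht (offWeight_nonneg (Gr n))
      (offWeight_comm (Gr n)) (offWeight_self (Gr n))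
    have hl := expect_perm_linStat_sq_le (n := n) (by omega) ht
      (d := fun a => (Ddeg (Gr n) a : ℝ)) fun a => Nat.cast_nonneg _
    simp only [sum_offWeight] at hq
    have hr2 : r n ^ 2 ≤ 4 / n ^ 2 := by
      have := pow_le_pow_left₀ (abs_nonneg _) (abs_weight_gap_le (by omega : 4 ≤ n) ht) 2
      rw [sq_abs, div_pow] at this
      norm_num at this
      exact this
    have hN2 : normalizer (Gr n) u (.inl i) ^ 2 =
        cindCov n (T n) (T n) ^ 2 * outScale (Gr n) := by
      have : 0 ≤ outScale (Gr n) := by unfold outScale; positivity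
      rw [normalizer, mul_pow, Real.sq_sqrt this]
    have hpt : ∀ p : (Fin n → Fin n) × Equiv.Perm (Fin n),
        ((rawStat (Gr n) u (.inl i) p.2 - (((T n : ℝ) / n) ^ 2 + ((T n : ℝ) - 1) / (n - 2) -
          2 * (((T n : ℝ) - 1) / (n - 2)) * (T n / n)) * (Gout (Gr n)).card) /
            normalizer (Gr n) u (.inl i) - normStat (Gr n) u (.inl i) (coupled p)) ^ 2 ≤
        (2 * (quadStat (offWeight (Gr n)) (T n) p.2 -
          quadStat (offWeight (Gr n)) (T n) (coupled p)) ^ 2 +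
          2 * r n ^ 2 * linStat (fun a => (Ddeg (Gr n) a : ℝ)) (T n) p.2 ^ 2) /
            normalizer (Gr n) u (.inl i) ^ 2 := by
      intro p
      rw [rawStat, normStat, Sum.elim_inl, Sum.elim_inl, ← sub_div, div_pow,
        Routw_eq_quadStat _ (by omega)]
      gcongr
      simp only [hr, hT]
      nlinarith [sq_nonneg ((quadStat (offWeight (Gr n)) (T n) p.2 -
          quadStat (offWeight (Gr n)) (T n) (coupled p)) +
          r n * linStat (fun a => (Ddeg (Gr n) a : ℝ)) (T n) p.2)]
    refine (expect_le_expect fun p _ => hpt p).trans ?_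
    rw [← expect_div, expect_add_distrib, ← mul_expect, ← mul_expect, hN2,
      expect_snd (fun σ => linStat (fun a => (Ddeg (Gr n) a : ℝ)) (T n) σ ^ 2)]
    rw [← univ_product_univ, expect_product]
    have hnum : 2 * (𝔼 V : Fin n → Fin n, 𝔼 σ : Equiv.Perm (Fin n),
        (quadStat (offWeight (Gr n)) (T n) σ -
          quadStat (offWeight (Gr n)) (T n) (coupled (V, σ))) ^ 2) + 2 * r n ^ 2 *
          (𝔼 σ : Equiv.Perm (Fin n), linStat (fun a => (Ddeg (Gr n) a : ℝ)) (T n) σ ^ 2) ≤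
        (40 * C * (√(n : ℝ))⁻¹ + 8 * C * ((√(n : ℝ))⁻¹) ^ 4) * n := by
      have e1 : 2 * (20 * (∑ a, (Ddeg (Gr n) a : ℝ) ^ 2) / √n) ≤ 2 * (20 * (C * n) / √n) := by
        gcongr
      have e2 : 2 * r n ^ 2 * (𝔼 σ : Equiv.Perm (Fin n),
          linStat (fun a => (Ddeg (Gr n) a : ℝ)) (T n) σ ^ 2) ≤ 2 * (4 / n ^ 2) * (C * n) := by
        gcongr
        exact hl.trans hCn
      have e3 : ((√(n : ℝ))⁻¹) ^ 4 = 1 / n ^ 2 := by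
        rw [inv_pow, show 4 = 2 * 2 from rfl, pow_mul, hs, one_div]
      have e4 : (40 * C * (√(n : ℝ))⁻¹ + 8 * C * (1 / n ^ 2)) * n =
          2 * (20 * (C * n) / √n) + 2 * (4 / n ^ 2) * (C * n) := by ring
      rw [e3, e4]
      exact add_le_add ((mul_le_mul_of_nonneg_left hq zero_le_two).trans e1) e2
    refine (div_le_div_of_nonneg_right hnum (mul_nonneg (sq_nonneg _) ?_)).trans ?_
    · unfold outScale; positivity
    have hden : cindCov n (T n) (T n) ^ 2 * (c * n) ≤
        cindCov n (T n) (T n) ^ 2 * outScale (Gr n) := by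
      gcongr
      exact hcn
    have hp : 0 < cindCov n (T n) (T n) := hpos
    refine (div_le_div_of_nonneg_left (by positivity) (by positivity) hden).trans (le_of_eq ?_)
    rw [← mul_assoc, mul_div_mul_right _ _ hn'.ne']
  · set T : ℕ → ℕ := fun n => ⌊(n : ℝ) * u i⌋₊ with hT
    refine ⟨fun n => (Gin (Gr n)).card * (T n / n), ?_⟩
    have hlim : Tendsto (fun n : ℕ => 2 * (√(n : ℝ))⁻¹ / cindCov n (T n) (T n)) atTop (𝓝 0) := by
      simpa [Pi.div_def, hT] using (hsqrt.const_mul 2).div (tendsto_cindCov (hu i).1.le (hu i).1.le)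
        (bridgeCov_self_pos (hu i)).ne'
    refine squeeze_zero' (Eventually.of_forall fun n => hnn n _) ?_ hlim
    filter_upwards [eventually_inScale_pos h2, eventually_ge_atTop 2,
      eventually_cindCov_pos hu i] with n hS hn hpos
    have ht : T n ≤ n := floor_mul_le (hu i) n
    have hl := expect_linStat_sub_sorted_sq_le hn ht (sum_diagWeight (Gr n) (by omega))
    have hN2 : normalizer (Gr n) u (.inr i) ^ 2 = cindCov n (T n) (T n) * inScale (Gr n) := by
      rw [normalizer, mul_pow, Real.sq_sqrt hS.le, Real.sq_sqrt hpos.le]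
    have hpt : ∀ p : (Fin n → Fin n) × Equiv.Perm (Fin n),
        ((rawStat (Gr n) u (.inr i) p.2 - (Gin (Gr n)).card * (T n / n)) /
            normalizer (Gr n) u (.inr i) - normStat (Gr n) u (.inr i) (coupled p)) ^ 2 =
        (linStat (diagWeight (Gr n)) (T n) p.2 -
          linStat (diagWeight (Gr n)) (T n) (coupled p)) ^ 2 /
            normalizer (Gr n) u (.inr i) ^ 2 := by
      intro p
      rw [rawStat, normStat, Sum.elim_inr, Sum.elim_inr, ← sub_div, div_pow,
        Rin1_eq_linStat _ (by omega) ht]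
      simp only [hT, add_sub_cancel_right]
    simp only [hpt]
    rw [← expect_div, hN2, ← univ_product_univ, expect_product]
    refine (div_le_div_of_nonneg_right hl (mul_pos hpos hS).le).trans (le_of_eq ?_)
    rw [← inScale, mul_comm (cindCov n (T n) (T n)), ← div_div]
    congr 1
    field_simp

end Coupling

section StandardizedStatistics

open Finset Filter Topology

variable {ℓ : ℕ} {Gr : ∀ n : ℕ, Finset (Sym2 (Node n ℓ))} {k : ℕ} {u : Fin k → ℝ}

lemma exists_mul_sqrt_le_normalizer (h1 : Cond1 ℓ Gr) (h2 : Cond2 ℓ Gr)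
    (hu : ∀ i, 0 < u i ∧ u i < 1) (s : Fin k ⊕ Fin k) :
    ∃ c : ℝ, 0 < c ∧ ∀ᶠ n : ℕ in atTop, c * √n ≤ normalizer (Gr n) u s := by
  have key : ∀ {a c S : ℝ} {n : ℕ}, 0 ≤ a → 0 ≤ c → c * n ≤ S → a * √c * √n ≤ a * √S := by
    intro a c S n ha hc h
    rw [mul_assoc, ← Real.sqrt_mul hc]
    gcongr
  rcases s with i | i
  · obtain ⟨c, hc, h⟩ := exists_le_sum_offWeight_sq h1
    have hb := bridgeCov_self_pos (hu i)
    refine ⟨bridgeCov (u i) (u i) / 2 * √c, by positivity, ?_⟩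
    filter_upwards [h, (tendsto_cindCov (hu i).1.le (hu i).1.le).eventually_const_le
      (half_lt_self hb)] with n hn hn'
    refine (key (by positivity) hc.le hn).trans ?_
    exact mul_le_mul_of_nonneg_right hn' (Real.sqrt_nonneg _)
  · obtain ⟨c, hc, h⟩ := exists_le_sum_diagWeight_sq h2
    have hb := bridgeCov_self_pos (hu i)
    refine ⟨√(bridgeCov (u i) (u i) / 2) * √c, by positivity, ?_⟩
    filter_upwards [h, (tendsto_cindCov (hu i).1.le (hu i).1.le).eventually_const_le
      (half_lt_self hb)] with n hn hn'
    refine (key (by positivity) hc.le hn).trans ?_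
    exact mul_le_mul_of_nonneg_right (Real.sqrt_le_sqrt hn') (Real.sqrt_nonneg _)

lemma sum_mul_normStat {n : ℕ} (G : Finset (Sym2 (Node n ℓ))) (θ : Fin k ⊕ Fin k → ℝ)
    (V : Fin n → Fin n) :
    ∑ s, θ s * normStat G u s V =
      ∑ i, θ (.inl i) / normalizer G u (.inl i) * quadStat (offWeight G) ⌊(n : ℝ) * u i⌋₊ V +
      ∑ i, θ (.inr i) / normalizer G u (.inr i) * linStat (diagWeight G) ⌊(n : ℝ) * u i⌋₊ V := by
  rw [Fintype.sum_sum_type]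
  congr 1 <;> refine sum_congr rfl fun i _ => ?_ <;>
    simp only [normStat, Sum.elim_inl, Sum.elim_inr] <;> ring

lemma tendsto_charFun_normStat_sub (h1 : Cond1 ℓ Gr) (h2 : Cond2 ℓ Gr) (h3 : Cond3 ℓ Gr)
    (hu : ∀ i, 0 < u i ∧ u i < 1) (θ : Fin k ⊕ Fin k → ℝ) :
    Tendsto (fun n => (𝔼 V, Complex.exp (Complex.I *
        ((∑ s, θ s * normStat (Gr n) u s V : ℝ) : ℂ))) -
      Complex.exp (((-((𝔼 V, (∑ s, θ s * normStat (Gr n) u s V) ^ 2) / 2) : ℝ) : ℂ)))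
      atTop (𝓝 0) := by
  choose c hc h using exists_mul_sqrt_le_normalizer (u := u) h1 h2 hu
  set L := ∑ s, |θ s| / c s with hL
  have hlim := (tendsto_sum_succ_cube_div h3).const_mul (64 * ((1 + (ℓ : ℝ) ^ 2) * L) ^ 3)
  rw [mul_zero] at hlim
  refine squeeze_zero_norm' ?_ hlim
  filter_upwards [eventually_all.2 h, eventually_gt_atTop 0] with n hN hn
  have hs : 0 < √(n : ℝ) := Real.sqrt_pos.2 (by exact_mod_cast hn)
  have hterm : ∀ s, |θ s / normalizer (Gr n) u s| ≤ |θ s| / c s / √n := by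
    intro s
    have hcs : 0 < c s * √(n : ℝ) := mul_pos (hc s) hs
    rw [abs_div, abs_of_pos (hcs.trans_le (hN s)), div_div]
    exact div_le_div_of_nonneg_left (abs_nonneg _) hcs (hN s)
  have hsum : ∑ i, |θ (.inl i) / normalizer (Gr n) u (.inl i)| +
      ∑ i, |θ (.inr i) / normalizer (Gr n) u (.inr i)| ≤ L / √n := by
    rw [← Fintype.sum_sum_type (f := fun s => |θ s / normalizer (Gr n) u s|), hL, sum_div]
    exact sum_le_sum fun s _ => hterm s
  have hl0 : 0 ≤ ∑ i, |θ (.inl i) / normalizer (Gr n) u (.inl i)| :=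
    sum_nonneg fun _ _ => abs_nonneg _
  have hr0 : 0 ≤ ∑ i, |θ (.inr i) / normalizer (Gr n) u (.inr i)| :=
    sum_nonneg fun _ _ => abs_nonneg _
  have hℓ : (0 : ℝ) ≤ (ℓ : ℝ) ^ 2 := by positivity
  simp only [sum_mul_normStat]
  refine (norm_charFun_stat_sub_gaussian_le (δ := (ℓ : ℝ) ^ 2)
    (K := (1 + (ℓ : ℝ) ^ 2) * (L / √n)) _ _ (fun i => floor_mul_le (hu i) n)
    (offWeight_nonneg (Gr n)) (offWeight_comm (Gr n)) (offWeight_self (Gr n))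
    (abs_diagWeight_le (Gr n) hn) ?_ ?_).trans (le_of_eq ?_)
  · nlinarith
  · nlinarith
  · ring

/-- The standardized statistics. -/
def zStat {n : ℕ} (G : Finset (Sym2 (Node n ℓ))) (u : Fin k → ℝ) (s : Fin k ⊕ Fin k)
    (σ : Equiv.Perm (Fin n)) : ℝ :=
  s.elim (fun i => Zoutw G ⌊(n : ℝ) * u i⌋₊ σ) (fun i => Zin G ⌊(n : ℝ) * u i⌋₊ σ)

lemma zStat_eq_stdz {n : ℕ} (G : Finset (Sym2 (Node n ℓ))) (u : Fin k → ℝ) (s : Fin k ⊕ Fin k) :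
    zStat G u s = stdz (rawStat G u s) := by
  funext σ
  rcases s with i | i <;>
    simp only [zStat, rawStat, stdz, Zoutw, Zin, pvar, pcov, pexp_eq_expect, Sum.elim_inl,
      Sum.elim_inr, sq]

lemma expect_stdz {Ω : Type*} [Fintype Ω] [Nonempty Ω] (f : Ω → ℝ) : 𝔼 ω, stdz f ω = 0 := by
  simp only [stdz, ← expect_div, expect_sub_distrib, Fintype.expect_const, sub_self, zero_div]

lemma pcov_zStat {n : ℕ} (G : Finset (Sym2 (Node n ℓ))) (u : Fin k → ℝ) (s s' : Fin k ⊕ Fin k) :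
    pcov (zStat G u s) (zStat G u s') = 𝔼 σ, zStat G u s σ * zStat G u s' σ := by
  simp only [pcov, pexp_eq_expect, zStat_eq_stdz, expect_stdz, sub_zero]

lemma stdz_comp_snd {n : ℕ} (f : Equiv.Perm (Fin n) → ℝ)
    (p : (Fin n → Fin n) × Equiv.Perm (Fin n)) :
    stdz (fun q : (Fin n → Fin n) × Equiv.Perm (Fin n) => f q.2) p = stdz f p.2 := by
  rw [stdz, stdz, expect_snd, expect_snd fun σ => (f σ - 𝔼 τ, f τ) ^ 2]

lemma tendsto_zStat_sub_normStat (h1 : Cond1 ℓ Gr) (h2 : Cond2 ℓ Gr)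
    (hu : ∀ i, 0 < u i ∧ u i < 1) (s : Fin k ⊕ Fin k) :
    Tendsto (fun n => 𝔼 p : (Fin n → Fin n) × Equiv.Perm (Fin n),
      (zStat (Gr n) u s p.2 - normStat (Gr n) u s (coupled p)) ^ 2) atTop (𝓝 0) := by
  have : ∀ n, Nonempty ((Fin n → Fin n) × Equiv.Perm (Fin n)) := fun n => ⟨(id, 1)⟩
  obtain ⟨K, hK⟩ := exists_tendsto_rawStat_sub_normStat h1 h2 hu s
  refine (tendsto_expect_stdz_sub_sq
    (Y := fun n (p : (Fin n → Fin n) × Equiv.Perm (Fin n)) => normStat (Gr n) u s (coupled p))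
    ?_ ?_ hK).congr' ?_
  · filter_upwards [eventually_gt_atTop 0] with n hn
    rw [expect_coupled, expect_normStat hu s hn]
  · have h := tendsto_expect_normStat_mul_normStat h1 h2 hu s s
    rw [limitCov_self hu] at h
    refine h.congr fun n => ?_
    rw [expect_coupled fun V => normStat (Gr n) u s V ^ 2]
    simp only [sq]
  · filter_upwards [eventually_normalizer_pos h1 h2 hu s] with n hn
    rw [stdz_sub_div _ _ hn]
    simp only [stdz_comp_snd, zStat_eq_stdz]

lemma tendsto_expect_zStat_mul_zStat (h1 : Cond1 ℓ Gr) (h2 : Cond2 ℓ Gr)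
    (hu : ∀ i, 0 < u i ∧ u i < 1) (s s' : Fin k ⊕ Fin k) :
    Tendsto (fun n => 𝔼 σ, zStat (Gr n) u s σ * zStat (Gr n) u s' σ) atTop
      (𝓝 (limitCov u s s')) := by
  have hmul : ∀ s s', Tendsto (fun n => 𝔼 p : (Fin n → Fin n) × Equiv.Perm (Fin n),
      normStat (Gr n) u s (coupled p) * normStat (Gr n) u s' (coupled p)) atTop
      (𝓝 (limitCov u s s')) := fun s s' =>
    (tendsto_expect_normStat_mul_normStat h1 h2 hu s s').congr fun n =>
      (expect_coupled fun V => normStat (Gr n) u s V * normStat (Gr n) u s' V).symm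
  have hsq : ∀ s, Tendsto (fun n => 𝔼 p : (Fin n → Fin n) × Equiv.Perm (Fin n),
      normStat (Gr n) u s (coupled p) ^ 2) atTop (𝓝 (limitCov u s s)) := fun s => by
    simpa only [sq] using hmul s s
  refine (tendsto_expect_mul_of_sub (tendsto_zStat_sub_normStat h1 h2 hu s)
    (tendsto_zStat_sub_normStat h1 h2 hu s') (hsq s) (hsq s') (hmul s s')).congr fun n => ?_
  exact expect_snd fun σ => zStat (Gr n) u s σ * zStat (Gr n) u s' σ

lemma tendsto_charFun_zStat (h1 : Cond1 ℓ Gr) (h2 : Cond2 ℓ Gr) (h3 : Cond3 ℓ Gr)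
    (hu : ∀ i, 0 < u i ∧ u i < 1) (θ : Fin k ⊕ Fin k → ℝ) :
    Tendsto (fun n => 𝔼 σ, Complex.exp (Complex.I * ((∑ s, θ s * zStat (Gr n) u s σ : ℝ) : ℂ)))
      atTop (𝓝 (Complex.exp (((-((∑ s, ∑ s', θ s * θ s' * limitCov u s s') / 2) : ℝ) : ℂ)))) := by
  have : ∀ n, Nonempty ((Fin n → Fin n) × Equiv.Perm (Fin n)) := fun n => ⟨(id, 1)⟩
  have hA := tendsto_expect_exp_sub
    (Z := fun s n (p : (Fin n → Fin n) × Equiv.Perm (Fin n)) => zStat (Gr n) u s p.2)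
    (Y := fun s n p => normStat (Gr n) u s (coupled p)) θ
    (tendsto_zStat_sub_normStat h1 h2 hu)
  have hB := tendsto_charFun_normStat_sub h1 h2 h3 hu θ
  have hsq : Tendsto (fun n => 𝔼 V, (∑ s, θ s * normStat (Gr n) u s V) ^ 2) atTop
      (𝓝 (∑ s, ∑ s', θ s * θ s' * limitCov u s s')) := by
    have := tendsto_finsetSum (univ : Finset (Fin k ⊕ Fin k)) fun s _ =>
      tendsto_finsetSum (univ : Finset (Fin k ⊕ Fin k)) fun s' _ =>
        (tendsto_expect_normStat_mul_normStat h1 h2 hu s s').const_mul (θ s * θ s')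
    refine this.congr fun n => ?_
    simp only [sq, sum_mul_sum, expect_sum_comm, mul_expect, mul_mul_mul_comm (θ _)]
  have hC : Tendsto (fun n => Complex.exp
      (((-((𝔼 V, (∑ s, θ s * normStat (Gr n) u s V) ^ 2) / 2) : ℝ) : ℂ))) atTop
      (𝓝 (Complex.exp (((-((∑ s, ∑ s', θ s * θ s' * limitCov u s s') / 2) : ℝ) : ℂ)))) :=
    (Complex.continuous_exp.comp Complex.continuous_ofReal).continuousAt.tendsto.comp
      (hsq.div_const 2).neg
  have h := (hA.add hB).add hC
  rw [add_zero, zero_add] at h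
  refine h.congr fun n => ?_
  rw [expect_snd fun σ => Complex.exp (Complex.I * ((∑ s, θ s * zStat (Gr n) u s σ : ℝ) : ℂ)),
    expect_coupled fun V => Complex.exp (Complex.I *
      ((∑ s, θ s * normStat (Gr n) u s V : ℝ) : ℂ))]
  ring

lemma posSemidef_limitCov (h1 : Cond1 ℓ Gr) (h2 : Cond2 ℓ Gr)
    (hu : ∀ i, 0 < u i ∧ u i < 1) : (limitCov u).PosSemidef := by
  have hlim := tendsto_expect_zStat_mul_zStat h1 h2 hu
  refine Matrix.PosSemidef.of_dotProduct_mulVec_nonneg ?_ fun x => ?_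
  · ext s s'
    rw [Matrix.conjTranspose_apply, star_trivial]
    refine tendsto_nhds_unique (hlim s' s) ((hlim s s').congr fun n => ?_)
    simp only [mul_comm]
  · have h : Tendsto (fun n => 𝔼 σ, (∑ s, x s * zStat (Gr n) u s σ) ^ 2) atTop
        (𝓝 (∑ s, ∑ s', x s * x s' * limitCov u s s')) := by
      have := tendsto_finsetSum (univ : Finset (Fin k ⊕ Fin k)) fun s _ =>
        tendsto_finsetSum (univ : Finset (Fin k ⊕ Fin k)) fun s' _ =>
          (hlim s s').const_mul (x s * x s')
      refine this.congr fun n => ?_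
      simp only [sq, sum_mul_sum, expect_sum_comm, mul_expect, mul_mul_mul_comm (x _)]
    have h0 := ge_of_tendsto' h fun n => expect_nonneg fun σ _ => sq_nonneg _
    refine h0.trans (le_of_eq ?_)
    simp only [dotProduct, Matrix.mulVec, star_trivial, mul_sum, Pi.star_apply]
    exact sum_congr rfl fun s _ => sum_congr rfl fun s' _ => by ring

end StandardizedStatistics

section GaussianLimit

open Finset Filter Topology MeasureTheory ProbabilityTheory

/-- The law of a random vector on a finite uniform probability space. -/
def uniformLaw {Ω E : Type*} [Fintype Ω] [Nonempty Ω] [MeasurableSpace E] (X : Ω → E) :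
    Measure E :=
  @Measure.map Ω E ⊤ _ X (@PMF.toMeasure Ω ⊤ (PMF.uniformOfFintype Ω))

section UniformLaw

variable {Ω E : Type*} [Fintype Ω] [Nonempty Ω] [MeasurableSpace E] (X : Ω → E)

instance isProbabilityMeasure_uniformLaw : IsProbabilityMeasure (uniformLaw X) := by
  let _ : MeasurableSpace Ω := ⊤
  exact Measure.isProbabilityMeasure_map (μ := (PMF.uniformOfFintype Ω).toMeasure)
    (measurable_from_top (f := X)).aemeasurable

lemma integral_uniformLaw {𝕜 : Type*} [RCLike 𝕜] [TopologicalSpace E] [OpensMeasurableSpace E]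
    [SecondCountableTopology E] {f : E → 𝕜} (hf : Continuous f) :
    ∫ x, f x ∂(uniformLaw X) = 𝔼 ω, f (X ω) := by
  let _ : MeasurableSpace Ω := ⊤
  rw [uniformLaw, integral_map (measurable_from_top (f := X)).aemeasurable
    hf.aestronglyMeasurable, PMF.integral_eq_sum, Fintype.expect_eq_sum_div_card, sum_div]
  refine sum_congr rfl fun ω _ => ?_
  rw [PMF.uniformOfFintype_apply, ENNReal.toReal_inv, ENNReal.toReal_natCast,
    RCLike.real_smul_eq_coe_mul]
  push_cast
  ring

end UniformLaw

variable {ι : Type*} [Fintype ι] [DecidableEq ι] {S : Matrix ι ι ℝ}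

lemma integral_eval_multivariateGaussian_zero (s : ι) :
    ∫ x, x s ∂(multivariateGaussian 0 S) = 0 := by
  have h := (EuclideanSpace.proj s : EuclideanSpace ℝ ι →L[ℝ] ℝ).integral_comp_comm
    (μ := multivariateGaussian 0 S) (φ := fun x => x) IsGaussian.integrable_fun_id
  simpa using h

lemma integral_eval_mul_eval_multivariateGaussian_zero (hS : S.PosSemidef) (s s' : ι) :
    ∫ x, x s * x s' ∂(multivariateGaussian 0 S) = S s s' := by
  have hL : ∀ s : ι, MemLp (fun x : EuclideanSpace ℝ ι => x s) 2 (multivariateGaussian 0 S) :=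
    fun s => IsGaussian.memLp_dual _ (EuclideanSpace.proj s : EuclideanSpace ℝ ι →L[ℝ] ℝ) 2
      (by simp)
  have h := covariance_eval_multivariateGaussian (μ := 0) hS s s'
  rw [covariance_eq_sub (hL s) (hL s'), integral_eval_multivariateGaussian_zero, zero_mul,
    sub_zero] at h
  exact h

lemma tendsto_expect_boundedContinuous_of_charFun {Ω : ℕ → Type*} [∀ n, Fintype (Ω n)]
    [∀ n, Nonempty (Ω n)] {Z : ∀ n, ι → Ω n → ℝ} (hS : S.PosSemidef)
    (h : ∀ θ : ι → ℝ, Tendsto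
      (fun n => 𝔼 ω, Complex.exp (Complex.I * ((∑ s, θ s * Z n s ω : ℝ) : ℂ))) atTop
      (𝓝 (Complex.exp (((-((∑ s, ∑ s', θ s * θ s' * S s s') / 2) : ℝ) : ℂ)))))
    (f : BoundedContinuousFunction (EuclideanSpace ℝ ι) ℝ) :
    Tendsto (fun n => 𝔼 ω, f (WithLp.toLp 2 fun s => Z n s ω)) atTop
      (𝓝 (∫ x, f x ∂(multivariateGaussian 0 S))) := by
  let P : ℕ → ProbabilityMeasure (EuclideanSpace ℝ ι) := fun n =>
    ⟨uniformLaw fun ω => WithLp.toLp 2 fun s => Z n s ω, isProbabilityMeasure_uniformLaw _⟩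
  let Q : ProbabilityMeasure (EuclideanSpace ℝ ι) := ⟨multivariateGaussian 0 S, inferInstance⟩
  have hlim : Tendsto P atTop (𝓝 Q) := by
    refine ProbabilityMeasure.tendsto_of_tendsto_charFun fun θ => ?_
    have hquad : θ.ofLp ⬝ᵥ S.mulVec θ.ofLp = ∑ s, ∑ s', θ s * θ s' * S s s' := by
      simp only [dotProduct, Matrix.mulVec, mul_sum]
      exact sum_congr rfl fun s _ => sum_congr rfl fun s' _ => by ring
    have hlimit : charFun (multivariateGaussian 0 S) θ =
        Complex.exp (((-((∑ s, ∑ s', θ s * θ s' * S s s') / 2) : ℝ) : ℂ)) := by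
      rw [charFun_multivariateGaussian hS]
      rw [hquad]
      simp
    change Tendsto _ _ (𝓝 (charFun (multivariateGaussian 0 S) θ))
    rw [hlimit]
    refine (h θ).congr fun n => ?_
    change _ = charFun (uniformLaw fun ω => WithLp.toLp 2 fun s => Z n s ω) θ
    rw [charFun_apply, integral_uniformLaw _ (by fun_prop)]
    refine expect_congr rfl fun ω _ => ?_
    rw [mul_comm]
    simp [PiLp.inner_apply]
  have := ProbabilityMeasure.tendsto_iff_forall_integral_tendsto.1 hlim f
  refine this.congr fun n => ?_
  exact integral_uniformLaw _ f.continuous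

/-- The splitting of a vector indexed by a sum type into its two blocks. -/
def splitCLM (k : ℕ) : EuclideanSpace ℝ (Fin k ⊕ Fin k) →L[ℝ] (Fin k → ℝ) × (Fin k → ℝ) :=
  (ContinuousLinearMap.pi fun i => EuclideanSpace.proj (.inl i)).prod
    (ContinuousLinearMap.pi fun i => EuclideanSpace.proj (.inr i))

variable {k : ℕ} {C : Matrix (Fin k ⊕ Fin k) (Fin k ⊕ Fin k) ℝ}

lemma isCenteredGaussian_map_splitCLM :
    IsCenteredGaussian ((multivariateGaussian 0 C).map (splitCLM k)) := by
  intro L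
  refine ⟨(variance (L.comp (splitCLM k)) (multivariateGaussian 0 C)).toNNReal, ?_⟩
  rw [Measure.map_map L.continuous.measurable (splitCLM k).continuous.measurable]
  change (multivariateGaussian 0 C).map (L.comp (splitCLM k)) = _
  rw [IsGaussian.map_eq_gaussianReal, ContinuousLinearMap.integral_comp_id_comm]
  · simp
  · exact IsGaussian.integrable_id

lemma map_splitCLM_eq_prod (hC : C.PosSemidef) (h0 : ∀ i j, C (.inl i) (.inr j) = 0) :
    (multivariateGaussian 0 C).map (splitCLM k) =
      ((multivariateGaussian 0 C).map (splitCLM k)).fst.prod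
        ((multivariateGaussian 0 C).map (splitCLM k)).snd := by
  have hG : HasGaussianLaw (fun x : EuclideanSpace ℝ (Fin k ⊕ Fin k) =>
      ((fun i => x (.inl i) : Fin k → ℝ), (fun j => x (.inr j) : Fin k → ℝ)))
      (multivariateGaussian 0 C) :=
    ⟨(inferInstance : IsGaussian ((multivariateGaussian 0 C).map (splitCLM k)))⟩
  have hI := hG.indepFun_of_covariance_eval fun i j =>
    (covariance_eval_multivariateGaussian hC (.inl i) (.inr j)).trans (h0 i j)
  rw [indepFun_iff_map_prod_eq_prod_map_map (by fun_prop) (by fun_prop)] at hI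
  rw [Measure.fst, Measure.snd, Measure.map_map measurable_fst (by fun_prop),
    Measure.map_map measurable_snd (by fun_prop)]
  exact hI

lemma integral_map_splitCLM {f : (Fin k → ℝ) × (Fin k → ℝ) → ℝ} (hf : Continuous f) :
    ∫ x, f x ∂((multivariateGaussian 0 C).map (splitCLM k)) =
      ∫ x, f (splitCLM k x) ∂(multivariateGaussian 0 C) :=
  integral_map (splitCLM k).continuous.measurable.aemeasurable hf.aestronglyMeasurable

end GaussianLimit

/-- Joint finite-dimensional convergence of `(Z_out,w, Z_in)` to a pair of
independent centered Gaussian processes, with covariance matrix the limit of the permutation-null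
covariance matrices. -/
theorem fdd_Zoutw_Zin (ℓ : ℕ) (Gr : ∀ n : ℕ, Finset (Sym2 (Node n ℓ)))
    (hG : ∀ n, ∀ e ∈ Gr n, ¬ e.IsDiag)
    (h1 : Cond1 ℓ Gr) (h2 : Cond2 ℓ Gr) (h3 : Cond3 ℓ Gr)
    (k : ℕ) (u : Fin k → ℝ) (hu : ∀ i, 0 < u i ∧ u i < 1) (hmono : StrictMono u) :
    ∃ μ : MeasureTheory.Measure ((Fin k → ℝ) × (Fin k → ℝ)),
      MeasureTheory.IsProbabilityMeasure μ ∧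
      IsCenteredGaussian μ ∧
      μ = μ.fst.prod μ.snd ∧
      (∀ f : BoundedContinuousFunction ((Fin k → ℝ) × (Fin k → ℝ)) ℝ,
        Filter.Tendsto
          (fun n : ℕ => pexp (fun σ =>
            f (fun i => Zoutw (Gr n) ⌊(n : ℝ) * u i⌋₊ σ,
               fun i => Zin (Gr n) ⌊(n : ℝ) * u i⌋₊ σ)))
          Filter.atTop (nhds (∫ x, f x ∂μ))) ∧
      (∀ i j : Fin k,
        Filter.Tendsto
          (fun n : ℕ => pcov (Zoutw (Gr n) ⌊(n : ℝ) * u i⌋₊) (Zoutw (Gr n) ⌊(n : ℝ) * u j⌋₊))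
          Filter.atTop (nhds (∫ x, x.1 i * x.1 j ∂μ)) ∧
        Filter.Tendsto
          (fun n : ℕ => pcov (Zoutw (Gr n) ⌊(n : ℝ) * u i⌋₊) (Zin (Gr n) ⌊(n : ℝ) * u j⌋₊))
          Filter.atTop (nhds (∫ x, x.1 i * x.2 j ∂μ)) ∧
        Filter.Tendsto
          (fun n : ℕ => pcov (Zin (Gr n) ⌊(n : ℝ) * u i⌋₊) (Zin (Gr n) ⌊(n : ℝ) * u j⌋₊))
          Filter.atTop (nhds (∫ x, x.2 i * x.2 j ∂μ))) := by
  have hC := posSemidef_limitCov h1 h2 hu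
  refine ⟨(ProbabilityTheory.multivariateGaussian 0 (limitCov u)).map (splitCLM k),
    MeasureTheory.Measure.isProbabilityMeasure_map (by fun_prop),
    isCenteredGaussian_map_splitCLM, map_splitCLM_eq_prod hC fun _ _ => rfl, fun f => ?_,
    fun i j => ?_⟩
  · rw [integral_map_splitCLM f.continuous]
    simp only [pexp_eq_expect]
    exact tendsto_expect_boundedContinuous_of_charFun (Z := fun n => zStat (Gr n) u) hC
      (tendsto_charFun_zStat h1 h2 h3 hu) (f.compContinuous ⟨splitCLM k, (splitCLM k).continuous⟩)
  · have key := fun s s' => tendsto_expect_zStat_mul_zStat h1 h2 hu s s'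
    simp only [← pcov_zStat, ← integral_eval_mul_eval_multivariateGaussian_zero hC] at key
    rw [integral_map_splitCLM (by fun_prop), integral_map_splitCLM (by fun_prop),
      integral_map_splitCLM (by fun_prop)]
    exact ⟨key (.inl i) (.inl j), key (.inl i) (.inr j), key (.inr i) (.inr j)⟩

end CPD
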